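/- arXiv:1601.06991 — 5 statements merged into one kernel-verified Lean document; each statement's English description precedes it below -/
import Mathlib

section
/- Let n ≥ 1 be an integer, 0 < q < 1, and let π have the Mallows distribution μ_{n,q}. Let 0 ≤ t < n and let g ⊆ {1,…,t}² be any set with P[Γ_π ∩ ({1,…,t}×{1,…,t}) = g] > 0, and set k := t − |g|. Then P[π(t+1) = t+1 | Γ_π ∩ ({1,…,t}×{1,…,t}) = g] = ((q^k − q^{k+1})/(1−q^{n−t})) · ((q^k − q^{n−t})/(1−q^{n−t})). -/
open Finset
open scoped Classical BigOperators

noncomputable section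

/-- Number of inversions of a permutation of `Fin n` (0-indexed positions). -/
def invCount (n : ℕ) (π : Equiv.Perm (Fin n)) : ℕ :=
  ((Finset.univ : Finset (Fin n × Fin n)).filter
    (fun p => p.1 < p.2 ∧ π p.2 < π p.1)).card

/-- Normalizing constant of the Mallows distribution. -/
def mallowsZ (n : ℕ) (q : ℝ) : ℝ :=
  ∑ σ : Equiv.Perm (Fin n), q ^ invCount n σ

/-- Mallows probability of an individual permutation. -/
def mallowsP (n : ℕ) (q : ℝ) (π : Equiv.Perm (Fin n)) : ℝ :=
  q ^ invCount n π / mallowsZ n q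

/-- Expectation of a real-valued functional under the Mallows distribution. -/
def mExp (n : ℕ) (q : ℝ) (X : Equiv.Perm (Fin n) → ℝ) : ℝ :=
  ∑ π : Equiv.Perm (Fin n), mallowsP n q π * X π

/-- Probability of an event under the Mallows distribution. -/
def mProb (n : ℕ) (q : ℝ) (A : Equiv.Perm (Fin n) → Prop) : ℝ :=
  ∑ π : Equiv.Perm (Fin n), if A π then mallowsP n q π else 0

/-- Conditional probability of `A` given `B` under the Mallows distribution. -/
def mCondProb (n : ℕ) (q : ℝ) (A B : Equiv.Perm (Fin n) → Prop) : ℝ :=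
  mProb n q (fun π => A π ∧ B π) / mProb n q B

/-- The graph `Γ_π = {(s, π(s))}` of a permutation, as a subset of `Fin n × Fin n`. -/
def graphP (n : ℕ) (π : Equiv.Perm (Fin n)) : Finset (Fin n × Fin n) :=
  Finset.univ.filter (fun p => π p.1 = p.2)

/-- The arc chain `κ_t(π) = |{i ∈ {1,…,t} : π(i) > t}|` (here expressed with
0-indexed positions and values of a permutation of `Fin n`). -/
def kappa (n t : ℕ) (π : Equiv.Perm (Fin n)) : ℕ :=
  (Finset.univ.filter (fun i : Fin n => (i : ℕ) < t ∧ t ≤ ((π i : ℕ)))).card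

lemma inv_swap_aux (n : ℕ) (π : Equiv.Perm (Fin n)) (p r : Fin n) (hpr : p < r)
    (hlt : π p < π r) (hb : ∀ i, p < i → i < r → π i < π p) :
    invCount n (π * Equiv.swap p r) = invCount n π + 1 := by
  unfold invCount
  have hmem : (p, r) ∈ (Finset.univ : Finset (Fin n × Fin n)).filter
    (fun x => x.1 < x.2 ∧ (π * Equiv.swap p r) x.2 < (π * Equiv.swap p r) x.1) := by
    refine Finset.mem_filter.2 ⟨Finset.mem_univ _, hpr, ?_⟩
    simpa using hlt
  rw [← Finset.card_erase_add_one hmem]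
  congr 1
  let s := Equiv.swap p r
  have key : ∀ a, (a = p ∧ s a = r) ∨ (a = r ∧ s a = p) ∨ (a ≠ p ∧ a ≠ r ∧ s a = a) := by
    intro a
    by_cases h : a = p
    · left; simp [s, h]
    by_cases h' : a = r
    · right; left; simp [s, h']
    right; right; exact ⟨h, h', Equiv.swap_apply_of_ne_of_ne h h'⟩
  have hss : ∀ a, s (s a) = a := fun a => Equiv.swap_apply_self p r a
  let f : Fin n × Fin n → Fin n × Fin n := fun x =>
    if (p < x.1 ∧ x.1 < r) ∨ (p < x.2 ∧ x.2 < r) then x else (s x.1, s x.2)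
  have hff : ∀ x, f (f x) = x := by
    rintro ⟨a, b⟩
    simp only [f]
    by_cases h : (p < a ∧ a < r) ∨ (p < b ∧ b < r)
    · simp [h]
    · rw [if_neg h]
      have : ¬ ((p < s a ∧ s a < r) ∨ (p < s b ∧ s b < r)) := by
        rcases key a with h1 | h1 | h1 <;> rcases key b with h2 | h2 | h2 <;> grind
      simp only [this, if_false, hss]
  refine Finset.card_nbij' f f ?_ ?_ (fun x _ => hff x) (fun x _ => hff x)
  · rintro ⟨a, b⟩ h
    rw [Finset.mem_coe, Finset.mem_erase, Finset.mem_filter] at h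
    replace h : (a, b) ≠ (p, r) ∧ a < b ∧ π (s b) < π (s a) := ⟨h.1, h.2.2⟩
    rw [Finset.mem_coe, Finset.mem_filter]
    refine ⟨Finset.mem_univ _, ?_⟩
    simp only [f]
    have e1 := hb a
    have e2 := hb b
    rcases key a with h1 | h1 | h1 <;> rcases key b with h2 | h2 | h2 <;> grind
  · rintro ⟨a, b⟩ h
    rw [Finset.mem_coe, Finset.mem_filter] at h
    replace h : a < b ∧ π b < π a := h.2
    rw [Finset.mem_coe, Finset.mem_erase, Finset.mem_filter]
    suffices f (a, b) ≠ (p, r) ∧ (f (a, b)).1 < (f (a, b)).2 ∧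
      π (s (f (a,b)).2) < π (s (f (a,b)).1) from ⟨this.1, Finset.mem_univ _, this.2⟩
    simp only [f]
    have e1 := hb a
    have e2 := hb b
    rcases key a with h1 | h1 | h1 <;> rcases key b with h2 | h2 | h2 <;> grind

lemma inv_inv_aux (n : ℕ) (π : Equiv.Perm (Fin n)) : invCount n π⁻¹ = invCount n π := by
  unfold invCount
  refine Finset.card_nbij' (fun x => (π⁻¹ x.2, π⁻¹ x.1)) (fun x => (π x.2, π x.1)) ?_ ?_ ?_ ?_
  · rintro ⟨a, b⟩ h
    simpa [and_comm] using h
  · rintro ⟨a, b⟩ h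
    simpa [and_comm] using h
  · rintro ⟨a, b⟩ h
    simp
  · rintro ⟨a, b⟩ h
    simp

/-- rank of `i` in `L`. -/
def rk (n : ℕ) (L : Finset (Fin n)) (i : Fin n) : ℕ := (L.filter (fun x => x < i)).card

lemma rk_lt (n : ℕ) (L : Finset (Fin n)) (i j : Fin n) (hi : i ∈ L) (hij : i < j) :
    rk n L i < rk n L j := by
  apply Finset.card_lt_card
  refine ⟨fun x hx => ?_, fun h => ?_⟩
  · simp only [Finset.mem_filter] at *
    exact ⟨hx.1, hx.2.trans hij⟩
  · have : i ∈ L.filter (fun x => x < i) := h (by simp [hi, hij])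
    simp at this

lemma rk_inj (n : ℕ) (L : Finset (Fin n)) (i j : Fin n) (hi : i ∈ L) (hj : j ∈ L)
    (h : rk n L i = rk n L j) : i = j := by
  rcases lt_trichotomy i j with h' | h' | h'
  · have := rk_lt n L i j hi h'; omega
  · exact h'
  · have := rk_lt n L j i hj h'; omega

lemma rk_lt_card (n : ℕ) (L : Finset (Fin n)) (i : Fin n) (hi : i ∈ L) : rk n L i < L.card := by
  apply Finset.card_lt_card
  refine ⟨Finset.filter_subset _ _, fun h => ?_⟩
  have : i ∈ L.filter (fun x => x < i) := h hi
  simp at this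

lemma rk_surj (n : ℕ) (L : Finset (Fin n)) (j : ℕ) (hj : j < L.card) :
    ∃ i ∈ L, rk n L i = j := by
  have := Finset.surj_on_of_inj_on_of_card_le (s := L) (t := Finset.range L.card)
    (fun i _ => rk n L i) (fun i hi => by simpa using rk_lt_card n L i hi)
    (fun a b ha hb h => rk_inj n L a b ha hb h) (by simp) j (by simpa using hj)
  obtain ⟨i, hi, h⟩ := this
  exact ⟨i, hi, h.symm⟩

/-- Positions of large values. -/
def LL (n t : ℕ) (π : Equiv.Perm (Fin n)) : Finset (Fin n) :=
  Finset.univ.filter (fun i => t ≤ (π i : ℕ))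

lemma LL_card (n t : ℕ) (π : Equiv.Perm (Fin n)) : (LL n t π).card = n - t := by
  have h1 : (LL n t π).card = (Finset.univ.filter (fun i : Fin n => t ≤ (i : ℕ))).card := by
    refine Finset.card_nbij' (fun x => π x) (fun x => π⁻¹ x) ?_ ?_ ?_ ?_ <;> intro x hx <;> simp_all [LL]
  have h2 : (Finset.univ.filter (fun i : Fin n => (i : ℕ) < t)).card = min n t := by
    exact Fin.card_filter_val_lt
  have h3 := Finset.card_filter_add_card_filter_not (s := (Finset.univ : Finset (Fin n)))
    (fun i : Fin n => (i : ℕ) < t)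
  simp only [not_lt, Finset.card_univ, Fintype.card_fin] at h3
  omega

/-- rank of the position of value `t`. -/
def bb (n t : ℕ) (ht : t < n) (π : Equiv.Perm (Fin n)) : ℕ :=
  rk n (LL n t π) (π⁻¹ ⟨t, ht⟩)

lemma step (n : ℕ) (q : ℝ) (t : ℕ) (ht : t < n) (C : Equiv.Perm (Fin n) → Prop)
    (hC : ∀ π, C π → ∀ v w : Fin n, t ≤ (v : ℕ) → t ≤ (w : ℕ) → C (Equiv.swap v w * π))
    (j : ℕ) (hj : j + 1 < n - t) :
    ∑ π ∈ Finset.univ.filter (fun π => C π ∧ bb n t ht π = j + 1), q ^ invCount n π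
      = q * ∑ π ∈ Finset.univ.filter (fun π => C π ∧ bb n t ht π = j), q ^ invCount n π := by
  have ex : ∀ L : Finset (Fin n), ∃ p : Fin n × Fin n, L.card = n - t →
      p.1 ∈ L ∧ rk n L p.1 = j ∧ p.2 ∈ L ∧ rk n L p.2 = j + 1 := by
    intro L
    by_cases h : L.card = n - t
    · obtain ⟨a, ha, ha'⟩ := rk_surj n L j (by omega)
      obtain ⟨b, hb, hb'⟩ := rk_surj n L (j + 1) (by omega)
      exact ⟨(a, b), fun _ => ⟨ha, ha', hb, hb'⟩⟩
    · exact ⟨(⟨t, ht⟩, ⟨t, ht⟩), fun h' => absurd h' h⟩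
  choose P hP using ex
  have hP' := fun π => hP (LL n t π) (LL_card n t π)
  let φ : Equiv.Perm (Fin n) → Equiv.Perm (Fin n) := fun π =>
    π * Equiv.swap (P (LL n t π)).1 (P (LL n t π)).2
  have hLφ : ∀ π, LL n t (φ π) = LL n t π := by
    intro π
    obtain ⟨h1, h2, h3, h4⟩ := hP' π
    ext i
    have hm : ∀ (σ : Equiv.Perm (Fin n)) x, x ∈ LL n t σ ↔ t ≤ (σ x : ℕ) := by
      intro σ x; simp [LL]
    rw [hm] at h1 h3
    rw [hm, hm]
    change t ≤ (π (Equiv.swap (P (LL n t π)).1 (P (LL n t π)).2 i) : ℕ) ↔ _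
    rw [Equiv.swap_apply_def]
    split_ifs with ha hb
    · rw [ha]; simp only [h1, h3]
    · rw [hb]; simp only [h1, h3]
    · rfl
  have hφφ : ∀ π, φ (φ π) = π := by
    intro π
    have : φ (φ π) = φ π * Equiv.swap (P (LL n t π)).1 (P (LL n t π)).2 := by
      conv_lhs => rw [show φ (φ π) = φ π * Equiv.swap (P (LL n t (φ π))).1 (P (LL n t (φ π))).2 from rfl]
      rw [hLφ]
    rw [this]
    simp [φ, mul_assoc]
  have htm : ∀ π : Equiv.Perm (Fin n), π⁻¹ ⟨t, ht⟩ ∈ LL n t π := by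
    intro π; simp [LL]
  have hCφ : ∀ π, C π → C (φ π) := by
    intro π h
    obtain ⟨h1, h2, h3, h4⟩ := hP' π
    simp only [φ]
    rw [Equiv.mul_swap_eq_swap_mul]
    exact hC π h _ _ (by simpa [LL] using h1) (by simpa [LL] using h3)
  have hbj : ∀ π, bb n t ht π = j ↔ π⁻¹ ⟨t, ht⟩ = (P (LL n t π)).1 := by
    intro π
    obtain ⟨h1, h2, h3, h4⟩ := hP' π
    constructor
    · intro h
      exact rk_inj n _ _ _ (htm π) h1 (by rw [h2]; exact h)
    · intro h
      unfold bb; rw [h, h2]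
  have hbj1 : ∀ π, bb n t ht π = j + 1 ↔ π⁻¹ ⟨t, ht⟩ = (P (LL n t π)).2 := by
    intro π
    obtain ⟨h1, h2, h3, h4⟩ := hP' π
    constructor
    · intro h
      exact rk_inj n _ _ _ (htm π) h3 (by rw [h4]; exact h)
    · intro h
      unfold bb; rw [h, h4]
  have hinvφ : ∀ π, (φ π)⁻¹ ⟨t, ht⟩ = Equiv.swap (P (LL n t π)).1 (P (LL n t π)).2 (π⁻¹ ⟨t, ht⟩) := by
    intro π
    simp [φ, mul_inv_rev]
  have hinv : ∀ π, bb n t ht π = j → invCount n (φ π) = invCount n π + 1 := by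
    intro π h
    obtain ⟨h1, h2, h3, h4⟩ := hP' π
    have h5 := (hbj π).1 h
    have h6 : π (P (LL n t π)).1 = ⟨t, ht⟩ := by rw [← h5]; simp
    have hlt : (P (LL n t π)).1 < (P (LL n t π)).2 := by
      by_contra hc
      rcases (not_lt.1 hc).eq_or_lt with h7 | h7
      · rw [h7] at h4; omega
      · have := rk_lt n _ _ _ h3 h7; omega
    apply inv_swap_aux n π _ _ hlt
    · rw [h6]
      have h8 : t ≤ (π (P (LL n t π)).2 : ℕ) := by simpa [LL] using h3
      have h9 : π (P (LL n t π)).2 ≠ ⟨t, ht⟩ := by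
        rw [← h6]; intro h; exact hlt.ne' (π.injective h)
      exact lt_of_le_of_ne (by simpa [Fin.le_def] using h8) h9.symm
    · intro i hi1 hi2
      rw [h6]
      by_contra hc
      have hi : i ∈ LL n t π := by simpa [LL, Fin.le_def] using hc
      have a1 := rk_lt n _ _ _ h1 hi1
      have a2 := rk_lt n _ _ _ hi hi2
      omega
  rw [Finset.mul_sum]
  symm
  refine Finset.sum_nbij' φ φ ?_ ?_ (fun π _ => hφφ π) (fun π _ => hφφ π) ?_
  · intro π h
    simp only [Finset.mem_filter, Finset.mem_univ, true_and] at h ⊢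
    refine ⟨hCφ π h.1, (hbj1 _).2 ?_⟩
    rw [hinvφ, hLφ, (hbj π).1 h.2, Equiv.swap_apply_left]
  · intro π h
    simp only [Finset.mem_filter, Finset.mem_univ, true_and] at h ⊢
    refine ⟨hCφ π h.1, (hbj _).2 ?_⟩
    rw [hinvφ, hLφ, (hbj1 π).1 h.2, Equiv.swap_apply_right]
  · intro π h
    simp only [Finset.mem_filter, Finset.mem_univ, true_and] at h
    rw [hinv π h.2, pow_succ]; ring

lemma law (n : ℕ) (q : ℝ) (t : ℕ) (ht : t < n) (C : Equiv.Perm (Fin n) → Prop)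
    (hC : ∀ π, C π → ∀ v w : Fin n, t ≤ (v : ℕ) → t ≤ (w : ℕ) → C (Equiv.swap v w * π))
    (j : ℕ) (hj : j < n - t) :
    (∑ π ∈ Finset.univ.filter (fun π => C π ∧ bb n t ht π = j), q ^ invCount n π) * (1 - q ^ (n - t))
      = q ^ j * (1 - q) * ∑ π ∈ Finset.univ.filter (fun π => C π), q ^ invCount n π := by
  let S : ℕ → ℝ := fun j => ∑ π ∈ Finset.univ.filter (fun π => C π ∧ bb n t ht π = j), q ^ invCount n π
  have h1 : ∀ j, j < n - t → S j = q ^ j * S 0 := by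
    intro j
    induction j with
    | zero => intro _; simp
    | succ j ih =>
      intro hj
      rw [show S (j+1) = q * S j from step n q t ht C hC j hj, ih (by omega), pow_succ]; ring
  have h2 : ∑ π ∈ Finset.univ.filter (fun π => C π), q ^ invCount n π
      = ∑ j ∈ Finset.range (n - t), S j := by
    rw [← Finset.sum_fiberwise_of_maps_to (t := Finset.range (n - t)) (g := bb n t ht)]
    · simp only [S, Finset.filter_filter]
    · intro π _
      rw [Finset.mem_range, ← LL_card n t π]
      exact rk_lt_card n _ _ (by simp [LL])
  have h3 : ∑ j ∈ Finset.range (n - t), S j = (∑ j ∈ Finset.range (n - t), q ^ j) * S 0 := by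
    rw [Finset.sum_mul]
    exact Finset.sum_congr rfl (fun j hj => h1 j (Finset.mem_range.1 hj))
  rw [h2, h3, show (∑ π ∈ Finset.univ.filter (fun π => C π ∧ bb n t ht π = j), q ^ invCount n π) = S j from rfl,
    h1 j hj, ← mul_neg_geom_sum q (n - t)]
  ring

lemma mem_LL (n t : ℕ) (σ : Equiv.Perm (Fin n)) (x : Fin n) : x ∈ LL n t σ ↔ t ≤ (σ x : ℕ) := by
  simp [LL]

/-- The event of the theorem. -/
def BB (n t : ℕ) (g : Finset (Fin n × Fin n)) (π : Equiv.Perm (Fin n)) : Prop :=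
  graphP n π ∩ Finset.univ.filter
          (fun p : Fin n × Fin n => (p.1 : ℕ) < t ∧ (p.2 : ℕ) < t) = g

lemma BB_iff (n t : ℕ) (g : Finset (Fin n × Fin n))
    (hg : ∀ p ∈ g, (p.1 : ℕ) < t ∧ (p.2 : ℕ) < t) (π : Equiv.Perm (Fin n)) :
    BB n t g π ↔ ∀ i v : Fin n, (i : ℕ) < t → (v : ℕ) < t → (π i = v ↔ (i, v) ∈ g) := by
  unfold BB graphP
  constructor
  · rintro rfl i v hi hv
    simp [hi, hv]
  · intro h
    ext ⟨i, v⟩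
    simp only [Finset.mem_inter, Finset.mem_filter, Finset.mem_univ, true_and]
    constructor
    · rintro ⟨h1, h2, h3⟩
      exact (h i v h2 h3).1 h1
    · intro h1
      obtain ⟨h2, h3⟩ := hg _ h1
      exact ⟨(h i v h2 h3).2 h1, h2, h3⟩

lemma rk_T (n t : ℕ) (ht : t < n) (π : Equiv.Perm (Fin n)) :
    rk n (LL n t π) ⟨t, ht⟩ +
      (Finset.univ.filter (fun i : Fin n => (i : ℕ) < t ∧ (π i : ℕ) < t)).card = t := by
  have h3 := Finset.card_filter_add_card_filter_not
    (s := (Finset.univ.filter (fun i : Fin n => (i : ℕ) < t))) (fun i : Fin n => t ≤ (π i : ℕ))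
  have h2 : (Finset.univ.filter (fun i : Fin n => (i : ℕ) < t)).card = min n t :=
    Fin.card_filter_val_lt
  rw [h2, Finset.filter_filter, Finset.filter_filter] at h3
  have h4 : rk n (LL n t π) ⟨t, ht⟩ =
      (Finset.univ.filter (fun i : Fin n => (i : ℕ) < t ∧ t ≤ (π i : ℕ))).card := by
    unfold rk LL
    rw [Finset.filter_filter]
    congr 1
    ext i
    simp [Fin.lt_def, and_comm]
  simp only [not_le] at h3
  omega

lemma card_g (n t : ℕ) (g : Finset (Fin n × Fin n))
    (hg : ∀ p ∈ g, (p.1 : ℕ) < t ∧ (p.2 : ℕ) < t) (π : Equiv.Perm (Fin n))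
    (h : BB n t g π) :
    (Finset.univ.filter (fun i : Fin n => (i : ℕ) < t ∧ (π i : ℕ) < t)).card = g.card := by
  rw [BB_iff n t g hg] at h
  refine Finset.card_nbij' (fun i => (i, π i)) (fun x => x.1) ?_ ?_ ?_ ?_
  · intro i hi
    rw [Finset.mem_coe, Finset.mem_filter] at hi
    exact (h i (π i) hi.2.1 hi.2.2).1 rfl
  · rintro ⟨i, v⟩ hi
    rw [Finset.mem_coe, Finset.mem_filter]
    obtain ⟨h2, h3⟩ := hg _ hi
    have := (h i v h2 h3).2 hi
    exact ⟨Finset.mem_univ _, h2, by simpa [this] using h3⟩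
  · intro i _; rfl
  · rintro ⟨i, v⟩ hi
    obtain ⟨h2, h3⟩ := hg _ hi
    simp [(h i v h2 h3).2 hi]

lemma card_g' (n t : ℕ) (g : Finset (Fin n × Fin n))
    (hg : ∀ p ∈ g, (p.1 : ℕ) < t ∧ (p.2 : ℕ) < t) (π : Equiv.Perm (Fin n))
    (h : BB n t g π) :
    (Finset.univ.filter (fun i : Fin n => (i : ℕ) < t ∧ (π⁻¹ i : ℕ) < t)).card = g.card := by
  rw [← card_g n t g hg π h]
  refine Finset.card_nbij' (fun x => π⁻¹ x) (fun x => π x) ?_ ?_ ?_ ?_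
  · intro i hi
    rw [Finset.mem_coe, Finset.mem_filter] at *
    simpa [and_comm] using hi.2
  · intro i hi
    rw [Finset.mem_coe, Finset.mem_filter] at *
    simpa [and_comm] using hi.2
  · intro i _; simp
  · intro i _; simp

lemma swap_small (n t : ℕ) (v w x : Fin n) (hv : t ≤ (v : ℕ)) (hw : t ≤ (w : ℕ))
    (hx : (x : ℕ) < t) : Equiv.swap v w x = x := by
  apply Equiv.swap_apply_of_ne_of_ne <;> rintro rfl <;> omega

lemma swap_large (n t : ℕ) (v w x : Fin n) (hv : t ≤ (v : ℕ)) (hw : t ≤ (w : ℕ))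
    (hx : t ≤ (x : ℕ)) : t ≤ (Equiv.swap v w x : ℕ) := by
  rw [Equiv.swap_apply_def]
  split_ifs <;> assumption

lemma BB_left (n t : ℕ) (g : Finset (Fin n × Fin n))
    (hg : ∀ p ∈ g, (p.1 : ℕ) < t ∧ (p.2 : ℕ) < t) (π : Equiv.Perm (Fin n))
    (h : BB n t g π) (v w : Fin n) (hv : t ≤ (v : ℕ)) (hw : t ≤ (w : ℕ)) :
    BB n t g (Equiv.swap v w * π) := by
  rw [BB_iff n t g hg] at *
  intro i x hi hx
  rw [← h i x hi hx, Equiv.Perm.mul_apply]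
  constructor
  · intro e
    have : π i = Equiv.swap v w x := by rw [← e, Equiv.swap_apply_self]
    rw [this, swap_small n t v w x hv hw hx]
  · intro e
    rw [e, swap_small n t v w x hv hw hx]

lemma BB_right (n t : ℕ) (g : Finset (Fin n × Fin n))
    (hg : ∀ p ∈ g, (p.1 : ℕ) < t ∧ (p.2 : ℕ) < t) (π : Equiv.Perm (Fin n))
    (h : BB n t g π) (v w : Fin n) (hv : t ≤ (v : ℕ)) (hw : t ≤ (w : ℕ)) :
    BB n t g (π * Equiv.swap v w) := by
  rw [BB_iff n t g hg] at *
  intro i x hi hx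
  rw [← h i x hi hx, Equiv.Perm.mul_apply, swap_small n t v w i hv hw hi]

lemma mProb_eq (n : ℕ) (q : ℝ) (A : Equiv.Perm (Fin n) → Prop) :
    mProb n q A = (∑ π ∈ Finset.univ.filter (fun π => A π), q ^ invCount n π) / mallowsZ n q := by
  unfold mProb mallowsP
  rw [Finset.sum_div, Finset.sum_filter]

lemma part_one (n : ℕ) (q : ℝ) (t : ℕ) (ht : t < n) (g : Finset (Fin n × Fin n))
    (hg : ∀ p ∈ g, (p.1 : ℕ) < t ∧ (p.2 : ℕ) < t) (k : ℕ) (hk : k = t - g.card)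
    (hkm : k < n - t) :
    (∑ π ∈ Finset.univ.filter (fun π => π ⟨t, ht⟩ = ⟨t, ht⟩ ∧ BB n t g π), q ^ invCount n π)
      * (1 - q ^ (n - t)) = q ^ k * (1 - q) *
      ∑ π ∈ Finset.univ.filter (fun π => BB n t g π ∧ t ≤ (π ⟨t, ht⟩ : ℕ)), q ^ invCount n π := by
  have hl := law n q t ht (fun π => BB n t g π ∧ t ≤ (π ⟨t, ht⟩ : ℕ)) ?_ k hkm
  · refine Eq.trans ?_ (hl.trans (by congr!))
    congr 1
    refine Finset.sum_congr ?_ (fun _ _ => rfl)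
    ext π
    simp only [Finset.mem_filter, Finset.mem_univ, true_and]
    have hr : BB n t g π → rk n (LL n t π) ⟨t, ht⟩ = k := by
      intro h
      have h1 := rk_T n t ht π
      rw [card_g n t g hg π h] at h1
      omega
    constructor
    · rintro ⟨h1, h2⟩
      refine ⟨⟨h2, by rw [h1]⟩, ?_⟩
      have : π⁻¹ ⟨t, ht⟩ = ⟨t, ht⟩ := by rw [Equiv.Perm.inv_eq_iff_eq, h1]
      unfold bb
      rw [this, hr h2]
    · rintro ⟨⟨h1, h2⟩, h3⟩
      refine ⟨?_, h1⟩
      have := rk_inj n (LL n t π) _ _ (by rw [mem_LL]; simp) ((mem_LL n t π _).2 h2)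
        (h3.trans (hr h1).symm)
      rw [Equiv.Perm.inv_eq_iff_eq] at this
      exact this.symm
  · rintro π ⟨h1, h2⟩ v w hv hw
    exact ⟨BB_left n t g hg π h1 v w hv hw, swap_large n t v w _ hv hw h2⟩

lemma part_two (n : ℕ) (q : ℝ) (t : ℕ) (ht : t < n) (g : Finset (Fin n × Fin n))
    (hg : ∀ p ∈ g, (p.1 : ℕ) < t ∧ (p.2 : ℕ) < t) (k : ℕ) (hk : k = t - g.card)
    (hkm : k ≤ n - t) :
    (∑ π ∈ Finset.univ.filter (fun π => BB n t g π ∧ t ≤ (π ⟨t, ht⟩ : ℕ)), q ^ invCount n π)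
      * (1 - q ^ (n - t)) = (q ^ k - q ^ (n - t)) *
      ∑ π ∈ Finset.univ.filter (fun π => BB n t g π), q ^ invCount n π := by
  have hL := law n q t ht (fun π => BB n t g π⁻¹) (by
    intro π h v w hv hw
    have := BB_right n t g hg _ h v w hv hw
    simpa [mul_inv_rev] using this)
  have e1 : ∑ π ∈ Finset.univ.filter (fun π => BB n t g π), q ^ invCount n π
      = ∑ π ∈ Finset.univ.filter (fun π => BB n t g π⁻¹), q ^ invCount n π := by
    refine Finset.sum_nbij' (fun π => π⁻¹) (fun π => π⁻¹) ?_ ?_ ?_ ?_ ?_ <;>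
      intro π h <;> simp_all [inv_inv_aux]
  have e2 : ∑ π ∈ Finset.univ.filter (fun π => BB n t g π ∧ t ≤ (π ⟨t, ht⟩ : ℕ)), q ^ invCount n π
      = ∑ j ∈ Finset.Ico k (n - t),
        ∑ π ∈ Finset.univ.filter (fun π => BB n t g π⁻¹ ∧ bb n t ht π = j), q ^ invCount n π := by
    have hiff : ∀ π, BB n t g π → (t ≤ (π ⟨t, ht⟩ : ℕ) ↔ k ≤ bb n t ht π⁻¹) := by
      intro π h
      have h1 := rk_T n t ht π⁻¹
      rw [card_g' n t g hg π h] at h1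
      have h2 : rk n (LL n t π⁻¹) ⟨t, ht⟩ = k := by omega
      have h3 : bb n t ht π⁻¹ = rk n (LL n t π⁻¹) (π ⟨t, ht⟩) := by simp [bb]
      rw [h3]
      constructor
      · intro h4
        rw [← h2]
        apply Finset.card_le_card
        intro x hx
        rw [Finset.mem_filter] at *
        exact ⟨hx.1, lt_of_lt_of_le hx.2 (by simpa [Fin.le_def] using h4)⟩
      · intro h4
        by_contra h5
        have := rk_lt n (LL n t π⁻¹) (π ⟨t, ht⟩) ⟨t, ht⟩ (by rw [mem_LL]; simp)
          (by simpa [Fin.lt_def] using h5)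
        omega
    have e3 : ∑ π ∈ Finset.univ.filter (fun π => BB n t g π ∧ t ≤ (π ⟨t, ht⟩ : ℕ)), q ^ invCount n π
      = ∑ π ∈ Finset.univ.filter (fun π => BB n t g π⁻¹ ∧ k ≤ bb n t ht π), q ^ invCount n π := by
      refine Finset.sum_nbij' (fun π => π⁻¹) (fun π => π⁻¹) ?_ ?_ ?_ ?_ ?_
      · intro π h
        rw [Finset.mem_filter] at *
        exact ⟨Finset.mem_univ _, by simpa using h.2.1, (hiff π h.2.1).1 h.2.2⟩
      · intro π h
        rw [Finset.mem_filter] at *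
        exact ⟨Finset.mem_univ _, h.2.1, (hiff _ h.2.1).2 (by simpa using h.2.2)⟩
      · intro π _; simp
      · intro π _; simp
      · intro π _; simp [inv_inv_aux]
    rw [e3, ← Finset.sum_fiberwise_of_maps_to (t := Finset.Ico k (n - t)) (g := bb n t ht)]
    · refine Finset.sum_congr rfl (fun j hj => ?_)
      rw [Finset.filter_filter]
      refine Finset.sum_congr ?_ (fun _ _ => rfl)
      ext π
      simp only [Finset.mem_filter, Finset.mem_univ, true_and]
      rw [Finset.mem_Ico] at hj
      constructor
      · rintro ⟨⟨h1, h2⟩, h3⟩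
        exact ⟨h1, h3⟩
      · rintro ⟨h1, h3⟩
        exact ⟨⟨h1, by omega⟩, h3⟩
    · intro π h
      rw [Finset.mem_filter] at h
      rw [Finset.mem_Ico]
      refine ⟨h.2.2, ?_⟩
      rw [← LL_card n t π]
      exact rk_lt_card n _ _ (by rw [mem_LL]; simp)
  rw [e1, e2, Finset.sum_mul, Finset.sum_congr rfl (fun j hj => hL j (Finset.mem_Ico.1 hj).2),
    ← Finset.sum_mul, ← Finset.sum_mul, geom_sum_Ico_mul_neg q hkm]

theorem mallows_fixed_point_probability
    (n : ℕ) (q : ℝ) (h0 : 0 < q) (h1 : q < 1)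
    (t : ℕ) (ht : t < n) (g : Finset (Fin n × Fin n))
    (hg : ∀ p ∈ g, (p.1 : ℕ) < t ∧ (p.2 : ℕ) < t)
    (hpos : 0 < mProb n q (fun π =>
      graphP n π ∩
        Finset.univ.filter
          (fun p : Fin n × Fin n => (p.1 : ℕ) < t ∧ (p.2 : ℕ) < t) = g))
    (k : ℕ) (hk : k = t - g.card) :
    mCondProb n q (fun π => π ⟨t, ht⟩ = ⟨t, ht⟩)
        (fun π => graphP n π ∩
          Finset.univ.filter
            (fun p : Fin n × Fin n => (p.1 : ℕ) < t ∧ (p.2 : ℕ) < t) = g)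
      = (q ^ k - q ^ (k + 1)) / (1 - q ^ (n - t)) *
          ((q ^ k - q ^ (n - t)) / (1 - q ^ (n - t))) := by
  have hBB : (fun π => graphP n π ∩ Finset.univ.filter
      (fun p : Fin n × Fin n => (p.1 : ℕ) < t ∧ (p.2 : ℕ) < t) = g) = BB n t g := rfl
  rw [hBB, mProb_eq] at hpos
  have hZ : 0 < mallowsZ n q :=
    Finset.sum_pos (fun σ _ => pow_pos h0 _) Finset.univ_nonempty
  have hA : 0 < ∑ π ∈ Finset.univ.filter (fun π => BB n t g π), q ^ invCount n π := by
    by_contra hc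
    exact absurd hpos (not_lt.2 (div_nonpos_of_nonpos_of_nonneg (not_lt.1 hc) hZ.le))
  have hq : 0 < 1 - q ^ (n - t) := by
    have := pow_lt_one₀ h0.le h1 (show n - t ≠ 0 by omega)
    linarith
  have hr : ∀ π, BB n t g π → rk n (LL n t π) ⟨t, ht⟩ = k := by
    intro π h
    have h1 := rk_T n t ht π
    rw [card_g n t g hg π h] at h1
    omega
  have hkm : k ≤ n - t := by
    have hne : (Finset.univ.filter (fun π => BB n t g π)).Nonempty := by
      rw [Finset.nonempty_iff_ne_empty]
      intro he
      rw [he] at hA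
      simp at hA
    obtain ⟨π, hπ⟩ := hne
    rw [← hr π (Finset.mem_filter.1 hπ).2, ← LL_card n t π]
    exact Finset.card_le_card (Finset.filter_subset _ _)
  have key : (∑ π ∈ Finset.univ.filter (fun π => π ⟨t, ht⟩ = ⟨t, ht⟩ ∧ BB n t g π),
      q ^ invCount n π) * (1 - q ^ (n - t)) = q ^ k * (1 - q) *
      ∑ π ∈ Finset.univ.filter (fun π => BB n t g π ∧ t ≤ (π ⟨t, ht⟩ : ℕ)), q ^ invCount n π := by
    rcases hkm.lt_or_eq with h | h
    · exact part_one n q t ht g hg k hk h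
    · have hem : ∀ π, BB n t g π → ¬ t ≤ (π ⟨t, ht⟩ : ℕ) := by
        intro π h2 h3
        have := rk_lt_card n (LL n t π) ⟨t, ht⟩ ((mem_LL n t π _).2 h3)
        rw [hr π h2, LL_card] at this
        omega
      rw [Finset.filter_false_of_mem, Finset.filter_false_of_mem]
      · simp
      · rintro π - ⟨h2, h3⟩
        exact hem π h2 h3
      · rintro π - ⟨h2, h3⟩
        exact hem π h3 (by rw [h2])
  have key2 := part_two n q t ht g hg k hk hkm
  unfold mCondProb
  have e : mProb n q (fun π => π ⟨t, ht⟩ = ⟨t, ht⟩ ∧ BB n t g π) =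
      (∑ π ∈ Finset.univ.filter (fun π => π ⟨t, ht⟩ = ⟨t, ht⟩ ∧ BB n t g π),
      q ^ invCount n π) / mallowsZ n q := by
    rw [mProb_eq]
    congr!
  rw [hBB]
  change mProb n q (fun π => π ⟨t, ht⟩ = ⟨t, ht⟩ ∧ BB n t g π) / _ = _
  rw [e, mProb_eq, div_div_div_cancel_right₀ hZ.ne', div_mul_div_comm, div_eq_div_iff hA.ne' (by positivity),
    ← mul_assoc, key, mul_assoc, key2]
  ring
end
end

section
/- Let n ≥ 1 be an integer, 0 < q < 1, and let π have the Mallows distribution μ_{n,q}. Then for every 0 ≤ t ≤ n and every integer d ≥ 1, P[κ_t(π) > ξ + d] ≤ q^{d²+d}/(1−q^{2d}), where ξ := min{i ∈ ℕ, i ≥ 1 : q^i ≤ 1/2}. -/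
open Finset
open scoped Classical BigOperators

noncomputable section

/-- Elementary symmetric sums of `1, q, …, q^(m-1)`, defined recursively. -/
def qE (q : ℝ) : ℕ → ℕ → ℝ
  | _, 0 => 1
  | 0, _ + 1 => 0
  | m + 1, j + 1 => qE q m (j + 1) + q ^ m * qE q m j

lemma qE_zero (q : ℝ) (m : ℕ) : qE q m 0 = 1 := by
  cases m <;> simp [qE]

lemma qE_succ (q : ℝ) (m j : ℕ) :
    qE q (m + 1) (j + 1) = qE q m (j + 1) + q ^ m * qE q m j := by
  simp [qE]

lemma qE_nonneg (q : ℝ) (h0 : 0 < q) (m : ℕ) : ∀ j, 0 ≤ qE q m j := by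
  induction m with
  | zero => intro j; cases j <;> simp [qE]
  | succ m ih =>
    intro j
    cases j with
    | zero => simp [qE]
    | succ j =>
      rw [qE_succ]
      have := ih j
      have := ih (j + 1)
      positivity

lemma qE_ratio (q : ℝ) (m : ℕ) :
    ∀ j, qE q m (j + 1) * (1 - q ^ (j + 1)) = (q ^ j - q ^ m) * qE q m j := by
  induction m with
  | zero => intro j; cases j <;> simp [qE]
  | succ m ih =>
    intro j
    cases j with
    | zero =>
      have h := ih 0
      rw [qE_succ]
      simp only [qE_zero] at h ⊢
      linear_combination h
    | succ j =>
      have h := ih (j + 1)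
      have h2 := ih j
      rw [qE_succ, qE_succ]
      linear_combination h + q ^ (m + 1) * h2

lemma sum_powersetCard_Ico (q : ℝ) (t m : ℕ) : ∀ j,
    ∑ B ∈ powersetCard j (Ico t (t + m)), q ^ (∑ b ∈ B, b) = q ^ (t * j) * qE q m j := by
  induction m with
  | zero =>
    intro j
    cases j with
    | zero => simp [qE]
    | succ j =>
      have : powersetCard (j + 1) (∅ : Finset ℕ) = ∅ := by
        apply powersetCard_eq_empty.2; simp
      simp [qE, this]
  | succ m ih =>
    intro j
    rcases j with _ | j
    · simp [qE]
    · have hI : Ico t (t + (m + 1)) = insert (t + m) (Ico t (t + m)) := by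
        ext x; simp; omega
      have hn : t + m ∉ Ico t (t + m) := by simp
      rw [hI, powersetCard_succ_insert hn, sum_union, ih, sum_image, qE_succ]
      · have : ∀ B ∈ powersetCard j (Ico t (t + m)),
            q ^ (∑ b ∈ insert (t + m) B, b) = q ^ (t + m) * q ^ (∑ b ∈ B, b) := by
          intro B hB
          have hB' : t + m ∉ B := fun h => hn ((mem_powersetCard.1 hB).1 h)
          rw [sum_insert hB', pow_add]
        rw [sum_congr rfl this, ← mul_sum, ih]
        simp only [Nat.succ_eq_add_one]
        ring
      · intro A hA B hB h
        have hA' : t + m ∉ A := fun h => hn ((mem_powersetCard.1 hA).1 h)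
        have hB' : t + m ∉ B := fun h => hn ((mem_powersetCard.1 hB).1 h)
        have := congrArg (fun s => s.erase (t + m)) h
        simpa [hA', hB'] using this
      · rw [disjoint_left]
        intro A hA hA2
        obtain ⟨B, hB, rfl⟩ := mem_image.1 hA2
        exact hn ((mem_powersetCard.1 hA).1 (mem_insert_self _ _))

/-- The set of values of `π` on the first `t` positions. -/
def imgSet (n t : ℕ) (π : Equiv.Perm (Fin n)) : Finset (Fin n) :=
  (Finset.univ.filter (fun i : Fin n => (i : ℕ) < t)).map π.toEmbedding

lemma mem_imgSet {n t : ℕ} {π : Equiv.Perm (Fin n)} {i : Fin n} :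
    π i ∈ imgSet n t π ↔ (i : ℕ) < t := by
  simp [imgSet]

lemma card_imgSet {n t : ℕ} (ht : t ≤ n) (π : Equiv.Perm (Fin n)) :
    (imgSet n t π).card = t := by
  simp [imgSet, Fin.card_filter_val_lt, ht]

lemma kappa_eq (n t : ℕ) (π : Equiv.Perm (Fin n)) :
    kappa n t π = ((imgSet n t π).filter (fun s : Fin n => t ≤ (s : ℕ))).card := by
  rw [imgSet, filter_map, card_map, filter_filter]
  rfl

/-- Pairs `(s,y)`, `s ∈ S`, `y ∉ S`, `y < s`. -/
def crossS {n : ℕ} (S : Finset (Fin n)) : ℕ :=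
  ((Finset.univ : Finset (Fin n × Fin n)).filter
    (fun p => p.1 ∈ S ∧ p.2 ∉ S ∧ p.2 < p.1)).card

/-- Pairs `(s,y)`, `s ∈ S`, `y ∈ S`, `y < s`. -/
def pairS {n : ℕ} (S : Finset (Fin n)) : ℕ :=
  ((Finset.univ : Finset (Fin n × Fin n)).filter
    (fun p => p.1 ∈ S ∧ p.2 ∈ S ∧ p.2 < p.1)).card

/-- Inversions internal to the first or the last block. -/
def withinInv (n t : ℕ) (π : Equiv.Perm (Fin n)) : ℕ :=
  ((Finset.univ : Finset (Fin n × Fin n)).filter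
    (fun p => (p.1 < p.2 ∧ π p.2 < π p.1) ∧ ((p.1 : ℕ) < t ↔ (p.2 : ℕ) < t))).card

lemma cross_add_pair {n : ℕ} (S : Finset (Fin n)) :
    crossS S + pairS S = ∑ s ∈ S, (s : ℕ) := by
  have h : ∀ s : Fin n, (s : ℕ) = (univ.filter (fun y : Fin n => y < s)).card := by
    intro s
    have : univ.filter (fun y : Fin n => y < s) = Iio s := by ext; simp
    rw [this, Fin.card_Iio]
  rw [crossS, pairS, ← card_union_of_disjoint]
  · rw [sum_congr rfl (fun s _ => h s), ← card_sigma]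
    apply card_bij (fun p _ => (⟨p.1, p.2⟩ : (_ : Fin n) × Fin n))
    · intro p hp; simp at hp ⊢; tauto
    · rintro ⟨a, b⟩ _ ⟨c, d⟩ _ h; simpa using h
    · rintro ⟨a, b⟩ h
      refine ⟨(a, b), ?_, rfl⟩
      simp at h ⊢; tauto
  · rw [disjoint_left]; intro p; simp; tauto

lemma inv_split (n t : ℕ) (π : Equiv.Perm (Fin n)) :
    invCount n π = withinInv n t π + crossS (imgSet n t π) := by
  rw [invCount, ← card_filter_add_card_filter_not
    (fun p : Fin n × Fin n => ((p.1 : ℕ) < t ↔ (p.2 : ℕ) < t)), filter_filter, filter_filter]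
  congr 1
  apply card_bij (fun p _ => (π p.1, π p.2))
  · rintro ⟨a, b⟩ h
    simp only [mem_filter, mem_univ, true_and, mem_imgSet, Fin.lt_def] at h ⊢
    refine ⟨?_, ?_, h.1.2⟩ <;> omega
  · rintro ⟨a, b⟩ _ ⟨c, d⟩ _ h; simpa using h
  · rintro ⟨a, b⟩ h
    refine ⟨(π.symm a, π.symm b), ?_, by simp⟩
    obtain ⟨a, rfl⟩ := π.surjective a
    obtain ⟨b, rfl⟩ := π.surjective b
    simp only [mem_filter, mem_univ, true_and, mem_imgSet, Fin.lt_def,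
      Equiv.symm_apply_apply] at h ⊢
    refine ⟨⟨?_, h.2.2⟩, ?_⟩ <;> omega

lemma exists_relabel {n : ℕ} (S S' : Finset (Fin n)) (h : S.card = S'.card) :
    ∃ σ : Equiv.Perm (Fin n), (∀ x, σ x ∈ S' ↔ x ∈ S) ∧
      ∀ x y, (x ∈ S ↔ y ∈ S) → (σ x < σ y ↔ x < y) := by
  have hc : Sᶜ.card = S'ᶜ.card := by rw [card_compl, card_compl, h]
  let e : S ≃o S' := (S.orderIsoOfFin rfl).symm.trans (S'.orderIsoOfFin h.symm)
  let f : (Sᶜ : Finset (Fin n)) ≃o (S'ᶜ : Finset (Fin n)) :=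
    (Sᶜ.orderIsoOfFin rfl).symm.trans (S'ᶜ.orderIsoOfFin hc.symm)
  let σf : Fin n → Fin n := fun x => if hx : x ∈ S then (e ⟨x, hx⟩ : Fin n)
    else (f ⟨x, mem_compl.2 hx⟩ : Fin n)
  have h1 : ∀ x (hx : x ∈ S), σf x = (e ⟨x, hx⟩ : Fin n) := fun x hx => dif_pos hx
  have h2 : ∀ x (hx : x ∉ S), σf x = (f ⟨x, mem_compl.2 hx⟩ : Fin n) := fun x hx => dif_neg hx
  have hm : ∀ x, σf x ∈ S' ↔ x ∈ S := by
    intro x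
    by_cases hx : x ∈ S
    · rw [h1 x hx]; simp [hx]
    · rw [h2 x hx]
      have := (f ⟨x, mem_compl.2 hx⟩).2
      rw [mem_compl] at this
      tauto
  have hl : ∀ x y, (x ∈ S ↔ y ∈ S) → (σf x < σf y ↔ x < y) := by
    intro x y hxy
    by_cases hx : x ∈ S
    · rw [h1 x hx, h1 y (hxy.1 hx), Subtype.coe_lt_coe, e.lt_iff_lt, Subtype.mk_lt_mk]
    · have hy : y ∉ S := fun hy => hx (hxy.2 hy)
      rw [h2 x hx, h2 y hy, Subtype.coe_lt_coe, f.lt_iff_lt, Subtype.mk_lt_mk]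
  have hinj : Function.Injective σf := by
    intro x y hxy
    have hs : x ∈ S ↔ y ∈ S := by rw [← hm x, ← hm y, hxy]
    have a := hl x y hs
    have b := hl y x hs.symm
    rw [hxy] at a b
    simp only [lt_self_iff_false, false_iff, not_lt] at a b
    exact le_antisymm b a
  exact ⟨Equiv.ofBijective σf (Finite.injective_iff_bijective.1 hinj), hm, hl⟩

lemma pairS_congr {n : ℕ} (S S' : Finset (Fin n)) (σ : Equiv.Perm (Fin n))
    (h1 : ∀ x, σ x ∈ S' ↔ x ∈ S) (h2 : ∀ x y, (x ∈ S ↔ y ∈ S) → (σ x < σ y ↔ x < y)) :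
    pairS S = pairS S' := by
  apply card_bij (fun p _ => (σ p.1, σ p.2))
  · rintro ⟨a, b⟩ h
    simp only [mem_filter, mem_univ, true_and, h1] at h ⊢
    refine ⟨h.1, h.2.1, (h2 _ _ (by tauto)).2 h.2.2⟩
  · rintro ⟨a, b⟩ _ ⟨c, d⟩ _ h; simpa using h
  · rintro ⟨a, b⟩ h
    obtain ⟨a, rfl⟩ := σ.surjective a
    obtain ⟨b, rfl⟩ := σ.surjective b
    refine ⟨(a, b), ?_, by simp⟩
    simp only [mem_filter, mem_univ, true_and, h1] at h ⊢
    refine ⟨h.1, h.2.1, (h2 _ _ (by tauto)).1 h.2.2⟩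

lemma imgSet_mul {n t : ℕ} (S S' : Finset (Fin n)) (σ π : Equiv.Perm (Fin n))
    (h1 : ∀ x, σ x ∈ S' ↔ x ∈ S) : imgSet n t (σ * π) = S' ↔ imgSet n t π = S := by
  rw [Finset.ext_iff, Finset.ext_iff]
  constructor
  · intro h x
    obtain ⟨i, rfl⟩ := π.surjective x
    have := h ((σ * π) i)
    rw [mem_imgSet] at this
    rw [mem_imgSet, this, Equiv.Perm.mul_apply, h1]
  · intro h x
    obtain ⟨i, rfl⟩ := (σ * π).surjective x
    have := h (π i)
    rw [mem_imgSet] at this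
    rw [mem_imgSet, this, Equiv.Perm.mul_apply, h1]

lemma inv_relabel {n t : ℕ} (S S' : Finset (Fin n)) (σ π : Equiv.Perm (Fin n))
    (h1 : ∀ x, σ x ∈ S' ↔ x ∈ S) (h2 : ∀ x y, (x ∈ S ↔ y ∈ S) → (σ x < σ y ↔ x < y))
    (hπ : imgSet n t π = S) :
    invCount n (σ * π) + ∑ s ∈ S, (s : ℕ) = invCount n π + ∑ s ∈ S', (s : ℕ) := by
  have hπ' := (imgSet_mul (t := t) S S' σ π h1).2 hπ
  have hw : withinInv n t (σ * π) = withinInv n t π := by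
    unfold withinInv
    congr 1
    apply filter_congr
    rintro ⟨a, b⟩ _
    have hab : ((a : ℕ) < t ↔ (b : ℕ) < t) → ((σ * π) b < (σ * π) a ↔ π b < π a) := by
      intro h
      rw [Equiv.Perm.mul_apply, Equiv.Perm.mul_apply]
      apply h2
      rw [← hπ, mem_imgSet, mem_imgSet, h]
    simp only
    tauto
  rw [inv_split n t (σ * π), inv_split n t π, hπ, hπ', hw, ← cross_add_pair S,
    ← cross_add_pair S', pairS_congr S S' σ h1 h2]
  ring

lemma fiber_sum {n t : ℕ} (ht : t ≤ n) (q : ℝ) (h0 : 0 < q) :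
    ∃ c : ℝ, 0 ≤ c ∧ ∀ S : Finset (Fin n), S.card = t →
      ∑ π ∈ univ.filter (fun π => imgSet n t π = S), q ^ invCount n π
        = c * q ^ (∑ s ∈ S, (s : ℕ)) := by
  let S0 := imgSet n t 1
  have hS0 : S0.card = t := card_imgSet ht 1
  refine ⟨(∑ π ∈ univ.filter (fun π => imgSet n t π = S0), q ^ invCount n π)
    / q ^ (∑ s ∈ S0, (s : ℕ)), by positivity, ?_⟩
  intro S hS
  obtain ⟨σ, h1, h2⟩ := exists_relabel S0 S (hS0.trans hS.symm)
  have hne : q ^ (∑ s ∈ S0, (s : ℕ)) ≠ 0 := by positivity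
  rw [div_mul_eq_mul_div, eq_div_iff hne, sum_mul, sum_mul]
  symm
  apply sum_bij (fun π _ => σ * π)
  · intro π hπ
    simp only [mem_filter, mem_univ, true_and] at hπ ⊢
    exact (imgSet_mul S0 S σ π h1).2 hπ
  · intro a _ b _ h; exact mul_left_cancel h
  · intro π hπ
    simp only [mem_filter, mem_univ, true_and] at hπ
    refine ⟨σ⁻¹ * π, ?_, by simp⟩
    simp only [mem_filter, mem_univ, true_and]
    rw [← imgSet_mul S0 S σ _ h1]
    simpa using hπ
  · intro π hπ
    simp only [mem_filter, mem_univ, true_and] at hπ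
    rw [← pow_add, ← pow_add, inv_relabel S0 S σ π h1 h2 hπ]

/-- Unnormalised weight of `κ_t = k`. -/
def kW (n t : ℕ) (q : ℝ) (k : ℕ) : ℝ :=
  ∑ π ∈ univ.filter (fun π => kappa n t π = k), q ^ invCount n π

lemma subset_sum {n t k : ℕ} (ht : t ≤ n) (hk : k ≤ t) (q : ℝ) :
    ∑ S ∈ (powersetCard t (univ : Finset (Fin n))).filter
        (fun S => (S.filter (fun s : Fin n => t ≤ (s : ℕ))).card = k), q ^ (∑ s ∈ S, (s : ℕ))
      = qE q t (t - k) * (q ^ (t * k) * qE q (n - t) k) := by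
  have e1 := sum_powersetCard_Ico q 0 t (t - k)
  have e2 := sum_powersetCard_Ico q t (n - t) k
  rw [show t + (n - t) = n by omega] at e2
  simp only [zero_mul, pow_zero, one_mul, zero_add] at e1
  rw [← e1, ← e2, sum_mul_sum, ← sum_product']
  have hval : ∀ (S : Finset (Fin n)), S.card
      = (S.filter (fun s : Fin n => t ≤ (s : ℕ))).card
        + (S.filter (fun s : Fin n => ¬ t ≤ (s : ℕ))).card := by
    intro S; rw [card_filter_add_card_filter_not]
  refine sum_bij' (fun S _ => ((S.filter (fun s : Fin n => ¬ t ≤ (s : ℕ))).map Fin.valEmbedding,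
      (S.filter (fun s : Fin n => t ≤ (s : ℕ))).map Fin.valEmbedding))
    (fun p _ => univ.filter (fun i : Fin n => (i : ℕ) ∈ p.1 ∪ p.2)) ?_ ?_ ?_ ?_ ?_
  · intro S hS
    simp only [mem_filter, mem_powersetCard] at hS
    have := hval S
    simp only [mem_product, mem_powersetCard, card_map]
    refine ⟨⟨?_, by omega⟩, ?_, hS.2⟩
    · intro x hx; simp at hx ⊢; grind
    · intro x hx; simp at hx ⊢; grind
  · rintro ⟨A, B⟩ hp
    simp only [mem_product, mem_powersetCard] at hp
    obtain ⟨⟨hA, hA'⟩, hB, hB'⟩ := hp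
    have key : ∀ i, i ∈ A → i < t := fun i hi => (mem_Ico.1 (hA hi)).2
    have keyB : ∀ i, i ∈ B → t ≤ i ∧ i < n := fun i hi => mem_Ico.1 (hB hi)
    have m1 : ((univ.filter (fun i : Fin n => (i : ℕ) ∈ A ∪ B)).filter
        (fun s : Fin n => ¬ t ≤ (s : ℕ))).map Fin.valEmbedding = A := by
      ext x; simp [Fin.exists_iff]; grind
    have m2 : ((univ.filter (fun i : Fin n => (i : ℕ) ∈ A ∪ B)).filter
        (fun s : Fin n => t ≤ (s : ℕ))).map Fin.valEmbedding = B := by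
      ext x; simp [Fin.exists_iff]; grind
    have c1 := congrArg card m1
    have c2 := congrArg card m2
    rw [card_map] at c1 c2
    simp only [mem_filter, mem_powersetCard, subset_univ, true_and]
    refine ⟨?_, by rw [c2, hB']⟩
    rw [hval, c1, c2]; omega
  · intro S hS
    ext x; simp [← Fin.ext_iff]; grind
  · rintro ⟨A, B⟩ hp
    simp only [mem_product, mem_powersetCard] at hp
    obtain ⟨⟨hA, hA'⟩, hB, hB'⟩ := hp
    have key : ∀ i, i ∈ A → i < t := fun i hi => (mem_Ico.1 (hA hi)).2
    have keyB : ∀ i, i ∈ B → t ≤ i ∧ i < n := fun i hi => mem_Ico.1 (hB hi)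
    apply Prod.ext
    · ext x; simp [Fin.exists_iff]; grind
    · ext x; simp [Fin.exists_iff]; grind
  · intro S hS
    rw [← pow_add]
    congr 1
    simp only [sum_map, Fin.valEmbedding_apply]
    rw [add_comm, sum_filter_add_sum_filter_not]

lemma kW_formula {n t : ℕ} (ht : t ≤ n) (q : ℝ) (h0 : 0 < q) :
    ∃ c : ℝ, 0 ≤ c ∧ ∀ k ≤ t,
      kW n t q k = c * (qE q t (t - k) * (q ^ (t * k) * qE q (n - t) k)) := by
  obtain ⟨c, hc, hS⟩ := fiber_sum ht q h0
  refine ⟨c, hc, fun k hk => ?_⟩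
  rw [← subset_sum ht hk q, mul_sum, kW]
  rw [← sum_fiberwise_of_maps_to (g := fun π => imgSet n t π)
    (t := (powersetCard t (univ : Finset (Fin n))).filter
        (fun S => (S.filter (fun s : Fin n => t ≤ (s : ℕ))).card = k))]
  · apply sum_congr rfl
    intro S hS'
    simp only [mem_filter, mem_powersetCard, subset_univ, true_and] at hS'
    rw [← hS S hS'.1, filter_filter]
    congr 1
    apply filter_congr
    intro π _
    rw [kappa_eq]
    constructor
    · exact fun h => h.2
    · intro h; rw [h]; exact ⟨hS'.2, rfl⟩
  · intro π hπ
    simp only [mem_filter, mem_univ, true_and, mem_powersetCard, subset_univ] at hπ ⊢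
    exact ⟨card_imgSet ht π, by rw [← kappa_eq, hπ]⟩

lemma kappa_le {n t : ℕ} (ht : t ≤ n) (π : Equiv.Perm (Fin n)) : kappa n t π ≤ t := by
  rw [kappa_eq]
  exact (card_filter_le _ _).trans (card_imgSet ht π).le

lemma kW_nonneg (n t : ℕ) (q : ℝ) (h0 : 0 < q) (k : ℕ) : 0 ≤ kW n t q k := by
  unfold kW; positivity

lemma kW_ratio {n t : ℕ} (ht : t ≤ n) (q : ℝ) (h0 : 0 < q) (h1 : q < 1) (k : ℕ) :
    kW n t q (k + 1) * (1 - q ^ (k + 1)) ^ 2 ≤ q ^ (2 * k + 1) * kW n t q k := by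
  by_cases hk : k + 1 ≤ t
  · obtain ⟨c, hc, hf⟩ := kW_formula ht q h0
    rw [hf (k + 1) hk, hf k (by omega)]
    obtain ⟨j, rfl⟩ : ∃ j, t = k + 1 + j := ⟨t - (k + 1), by omega⟩
    rw [show k + 1 + j - (k + 1) = j by omega, show k + 1 + j - k = j + 1 by omega]
    have r1 := qE_ratio q (k + 1 + j) j
    have r2 := qE_ratio q (n - (k + 1 + j)) k
    have n1 := qE_nonneg q h0 (k + 1 + j) j
    have n2 := qE_nonneg q h0 (k + 1 + j) (j + 1)
    have n3 := qE_nonneg q h0 (n - (k + 1 + j)) k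
    have n4 := qE_nonneg q h0 (n - (k + 1 + j)) (k + 1)
    set X := qE q (k + 1 + j) j
    set Y := qE q (k + 1 + j) (j + 1)
    set U := qE q (n - (k + 1 + j)) k
    set V := qE q (n - (k + 1 + j)) (k + 1)
    have p1 : q ^ (k + 1) ≤ 1 := pow_le_one₀ h0.le h1.le
    have p2 : 0 < q ^ (j + 1) := by positivity
    have p3 : 0 < q ^ (n - (k + 1 + j)) := by positivity
    have b1 : q ^ j * ((1 - q ^ (k + 1)) * X) ≤ Y := by
      have : q ^ j * ((1 - q ^ (k + 1)) * X) = Y * (1 - q ^ (j + 1)) := by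
        rw [r1]; ring
      rw [this]; nlinarith
    have b2 : V * (1 - q ^ (k + 1)) ≤ q ^ k * U := by
      rw [r2]; nlinarith
    have b3 : 0 ≤ V * (1 - q ^ (k + 1)) := mul_nonneg n4 (by linarith)
    have b4 := mul_le_mul b1 b2 b3 n2
    have b5 : 0 ≤ c * q ^ ((k + 1 + j) * k + (k + 1)) := by positivity
    calc c * (X * (q ^ ((k + 1 + j) * (k + 1)) * V)) * (1 - q ^ (k + 1)) ^ 2
        = c * q ^ ((k + 1 + j) * k + (k + 1)) *
          (q ^ j * ((1 - q ^ (k + 1)) * X) * (V * (1 - q ^ (k + 1)))) := by ring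
      _ ≤ c * q ^ ((k + 1 + j) * k + (k + 1)) * (Y * (q ^ k * U)) :=
          mul_le_mul_of_nonneg_left b4 b5
      _ = _ := by ring
  · have : kW n t q (k + 1) = 0 := by
      unfold kW
      rw [filter_false_of_mem, sum_empty]
      intro π _ h
      have := kappa_le ht π
      omega
    rw [this, zero_mul]
    have := kW_nonneg n t q h0 k
    positivity

lemma kW_tail {n t : ℕ} (ht : t ≤ n) (q : ℝ) (h0 : 0 < q) (h1 : q < 1) (x : ℕ)
    (hx : q ^ x ≤ 1 / 2) (j : ℕ) : kW n t q (x + j) ≤ q ^ (j ^ 2) * mallowsZ n q := by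
  induction j with
  | zero =>
    simp only [add_zero, ne_eq, OfNat.ofNat_ne_zero, not_false_eq_true, zero_pow, pow_zero, one_mul]
    unfold kW mallowsZ
    exact sum_le_sum_of_subset_of_nonneg (filter_subset _ _) (fun _ _ _ => by positivity)
  | succ j ih =>
    have hr := kW_ratio ht q h0 h1 (x + j)
    have hW := kW_nonneg n t q h0 (x + j + 1)
    have hW0 := kW_nonneg n t q h0 (x + j)
    have hp : q ^ (x + j + 1) ≤ q ^ x := pow_le_pow_of_le_one h0.le h1.le (by omega)
    have hs : (1 / 4 : ℝ) ≤ (1 - q ^ (x + j + 1)) ^ 2 := by nlinarith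
    have hx2 : (q ^ x) ^ 2 ≤ 1 / 4 := by
      have : 0 < q ^ x := by positivity
      nlinarith
    have a1 : kW n t q (x + j + 1) * (1 / 4) ≤ q ^ (2 * (x + j) + 1) * kW n t q (x + j) :=
      (mul_le_mul_of_nonneg_left hs hW).trans hr
    have a2 : q ^ (2 * (x + j) + 1) * kW n t q (x + j)
        ≤ 1 / 4 * (q ^ (2 * j + 1) * kW n t q (x + j)) := by
      have : q ^ (2 * (x + j) + 1) * kW n t q (x + j)
        = (q ^ x) ^ 2 * (q ^ (2 * j + 1) * kW n t q (x + j)) := by ring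
      rw [this]
      exact mul_le_mul_of_nonneg_right hx2 (by positivity)
    have a3 : q ^ (2 * j + 1) * kW n t q (x + j)
        ≤ q ^ (2 * j + 1) * (q ^ (j ^ 2) * mallowsZ n q) :=
      mul_le_mul_of_nonneg_left ih (by positivity)
    have a4 : q ^ (2 * j + 1) * (q ^ (j ^ 2) * mallowsZ n q)
        = q ^ ((j + 1) ^ 2) * mallowsZ n q := by ring
    rw [← add_assoc]
    linarith

lemma mallowsZ_pos (n : ℕ) (q : ℝ) (h0 : 0 < q) : 0 < mallowsZ n q := by
  unfold mallowsZ
  exact sum_pos (fun _ _ => by positivity) univ_nonempty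

lemma mProb_le {n t : ℕ} (ht : t ≤ n) (q : ℝ) (h0 : 0 < q) (m : ℕ) :
    mProb n q (fun π => m < kappa n t π)
      ≤ ∑ i ∈ range n, kW n t q (m + 1 + i) / mallowsZ n q := by
  have hZ := mallowsZ_pos n q h0
  have hP : ∀ π, 0 ≤ mallowsP n q π := fun π => by unfold mallowsP; positivity
  have e : ∀ k, kW n t q k / mallowsZ n q
      = ∑ π : Equiv.Perm (Fin n), if kappa n t π = k then mallowsP n q π else 0 := by
    intro k
    rw [kW, sum_div, sum_filter]
    rfl
  simp only [e]
  rw [sum_comm]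
  unfold mProb
  apply sum_le_sum
  intro π _
  have hnn : ∀ i ∈ range n, (0 : ℝ) ≤ if kappa n t π = m + 1 + i then mallowsP n q π else 0 := by
    intro i _; split_ifs
    · exact hP π
    · exact le_rfl
  split_ifs with h
  · have hk := kappa_le ht π
    have hmem : kappa n t π - (m + 1) ∈ range n := by rw [mem_range]; omega
    refine le_trans ?_ (single_le_sum hnn hmem)
    rw [if_pos (by omega)]
  · exact sum_nonneg hnn

theorem mallows_arc_chain_tail_bound
    (n : ℕ) (hn : 1 ≤ n) (q : ℝ) (h0 : 0 < q) (h1 : q < 1)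
    (t : ℕ) (ht : t ≤ n) (d : ℕ) (hd : 1 ≤ d) :
    mProb n q (fun π =>
        sInf {i : ℕ | 0 < i ∧ q ^ i ≤ 1 / 2} + d < kappa n t π)
      ≤ q ^ (d ^ 2 + d) / (1 - q ^ (2 * d)) := by
  have hZ := mallowsZ_pos n q h0
  have hne : {i : ℕ | 0 < i ∧ q ^ i ≤ 1 / 2}.Nonempty := by
    obtain ⟨N, hN⟩ := exists_pow_lt_of_lt_one (show (0 : ℝ) < 1 / 2 by norm_num) h1
    exact ⟨N + 1, by omega, (pow_le_pow_of_le_one h0.le h1.le (by omega)).trans hN.le⟩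
  have hx := (Nat.sInf_mem hne).2
  set x := sInf {i : ℕ | 0 < i ∧ q ^ i ≤ 1 / 2}
  refine (mProb_le ht q h0 (x + d)).trans ?_
  have hr0 : 0 ≤ q ^ (2 * d) := by positivity
  have hr1 : q ^ (2 * d) < 1 := pow_lt_one₀ h0.le h1 (by omega)
  have hterm : ∀ i ∈ range n, kW n t q (x + d + 1 + i) / mallowsZ n q
      ≤ q ^ (d ^ 2 + d) * (q ^ (2 * d)) ^ i := by
    intro i _
    rw [div_le_iff₀ hZ]
    have := kW_tail ht q h0 h1 x hx (d + 1 + i)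
    rw [show x + (d + 1 + i) = x + d + 1 + i by ring] at this
    refine this.trans (mul_le_mul_of_nonneg_right ?_ hZ.le)
    rw [← pow_mul, ← pow_add]
    apply pow_le_pow_of_le_one h0.le h1.le
    nlinarith [Nat.zero_le i, Nat.zero_le d]
  refine (sum_le_sum hterm).trans ?_
  rw [← mul_sum, div_eq_mul_inv]
  apply mul_le_mul_of_nonneg_left _ (by positivity)
  rw [← tsum_geometric_of_lt_one hr0 hr1]
  exact (summable_geometric_of_lt_one hr0 hr1).sum_le_tsum _ (fun _ _ => by positivity)
end
end

section
/- Let 0 < q < 1 and define, for integers i ≥ 1, w_i := q^{2i−1}/(1−q^i)², and for integers s ≥ 0 define ν_s := (∏_{i=1}^{s} w_i) / (Σ_{j=0}^{∞} ∏_{i=1}^{j} w_i), where empty products equal 1 (the series in the denominator converges). Let ξ := min{i ∈ ℕ, i ≥ 1 : q^i ≤ 1/2}. Then: (a) ν_x ≤ 2^{2ξ−x} for every integer x ≥ 0 and every q ∈ (0,1); and (b) ν_x ≤ 4q/2^x for every integer x ≥ 1 and every q ∈ (0,1/4). -/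
open Finset
open scoped BigOperators

noncomputable section

/-- The ratio `w_i = u_i / v_i = q^{2i-1} / (1-q^i)^2` of the up- and down-transition
probabilities of the `(∞,q)`-arc chain. -/
def wAC (q : ℝ) (i : ℕ) : ℝ := q ^ (2 * i - 1) / (1 - q ^ i) ^ 2

/-- The partial product `∏_{i=1}^{s} w_i` (empty product is `1`). -/
def prodW (q : ℝ) (s : ℕ) : ℝ := ∏ i ∈ Finset.Icc 1 s, wAC q i

/-- The stationary distribution of the `(∞,q)`-arc chain:
`ν_s = (∏_{i=1}^{s} w_i) / (Σ_{j≥0} ∏_{i=1}^{j} w_i)`. -/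
def nuAC (q : ℝ) (s : ℕ) : ℝ := prodW q s / ∑' j : ℕ, prodW q j

lemma wAC_pos (q : ℝ) (h0 : 0 < q) (h1 : q < 1) (i : ℕ) (hi : 1 ≤ i) : 0 < wAC q i := by
  unfold wAC
  have : q ^ i < 1 := pow_lt_one₀ h0.le h1 (by omega)
  have h2 : 0 < 1 - q ^ i := by linarith
  positivity

lemma wAC_le_half (q : ℝ) (h0 : 0 < q) (h1 : q < 1) (i : ℕ) (hi : 1 ≤ i)
    (h : q ^ i ≤ 1 / 4) : wAC q i ≤ 1 / 2 := by
  unfold wAC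
  have h2 : q ^ (2 * i - 1) ≤ q ^ i := pow_le_pow_of_le_one h0.le h1.le (by omega)
  have h3 : 0 < 1 - q ^ i := by linarith
  rw [div_le_iff₀ (by positivity)]
  nlinarith

lemma prodW_pos (q : ℝ) (h0 : 0 < q) (h1 : q < 1) (s : ℕ) : 0 < prodW q s := by
  unfold prodW
  exact Finset.prod_pos fun i hi => wAC_pos q h0 h1 i (Finset.mem_Icc.mp hi).1

lemma prodW_succ (q : ℝ) (s : ℕ) : prodW q (s + 1) = prodW q s * wAC q (s + 1) := by
  unfold prodW
  exact Finset.prod_Icc_succ_top (by omega) _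

lemma prodW_decay (q : ℝ) (h0 : 0 < q) (h1 : q < 1) (N : ℕ)
    (h : ∀ i, N < i → wAC q i ≤ 1 / 2) (k : ℕ) :
    prodW q (N + k) ≤ prodW q N * (1 / 2) ^ k := by
  induction k with
  | zero => simp
  | succ k ih =>
    rw [← add_assoc, prodW_succ, pow_succ, ← mul_assoc]
    exact mul_le_mul ih (h _ (by omega)) (wAC_pos q h0 h1 _ (by omega)).le
      (mul_nonneg (prodW_pos q h0 h1 N).le (by positivity))

lemma prodW_summable (q : ℝ) (h0 : 0 < q) (h1 : q < 1) (N : ℕ)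
    (h : ∀ i, N < i → wAC q i ≤ 1 / 2) : Summable (prodW q) := by
  rw [← summable_nat_add_iff N]
  refine Summable.of_nonneg_of_le (fun k => (prodW_pos q h0 h1 _).le) (fun k => ?_)
    ((summable_geometric_two).mul_left (prodW q N))
  rw [add_comm]
  exact prodW_decay q h0 h1 N h k

theorem stationary_distribution_bounds (q : ℝ) (h0 : 0 < q) (h1 : q < 1) :
    (∀ x : ℕ, nuAC q x ≤
      (2 : ℝ) ^ (2 * ((sInf {i : ℕ | 0 < i ∧ q ^ i ≤ 1 / 2} : ℕ) : ℤ) - (x : ℤ))) ∧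
    (q < 1 / 4 → ∀ x : ℕ, 1 ≤ x → nuAC q x ≤ 4 * q / 2 ^ x) := by
  set ξ := sInf {i : ℕ | 0 < i ∧ q ^ i ≤ 1 / 2} with hξ
  have hmem : ξ ∈ {i : ℕ | 0 < i ∧ q ^ i ≤ 1 / 2} := by
    apply Nat.sInf_mem
    obtain ⟨n, hn⟩ := exists_pow_lt_of_lt_one (show (0 : ℝ) < 1 / 2 by norm_num) h1
    refine ⟨n + 1, by omega, ?_⟩
    exact (pow_le_pow_of_le_one h0.le h1.le (by omega)).trans hn.le
  obtain ⟨hpos, hle⟩ := hmem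
  have hdec : ∀ i, 2 * ξ < i → wAC q i ≤ 1 / 2 := by
    intro i hi
    refine wAC_le_half q h0 h1 i (by omega) ?_
    have h2 : q ^ i ≤ q ^ (ξ + ξ) := pow_le_pow_of_le_one h0.le h1.le (by omega)
    rw [pow_add] at h2
    have h3 : 0 < q ^ ξ := by positivity
    nlinarith
  have hs := prodW_summable q h0 h1 _ hdec
  have hterm : ∀ x, prodW q x ≤ ∑' j : ℕ, prodW q j := fun x =>
    hs.le_tsum x fun j _ => (prodW_pos q h0 h1 j).le
  have hS : 0 < ∑' j : ℕ, prodW q j := (prodW_pos q h0 h1 0).trans_le (hterm 0)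
  constructor
  · intro x
    unfold nuAC
    rw [div_le_iff₀ hS]
    rcases le_total x (2 * ξ) with hx | hx
    · have h2 : (1 : ℝ) ≤ (2 : ℝ) ^ (2 * (ξ : ℤ) - (x : ℤ)) :=
        one_le_zpow₀ (by norm_num) (by omega)
      nlinarith [hterm x]
    · obtain ⟨k, rfl⟩ := Nat.exists_eq_add_of_le hx
      have h2 : (2 : ℝ) ^ (2 * (ξ : ℤ) - ((2 * ξ + k : ℕ) : ℤ)) = (1 / 2) ^ k := by
        have : 2 * (ξ : ℤ) - ((2 * ξ + k : ℕ) : ℤ) = -(k : ℤ) := by push_cast; ring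
        rw [this, zpow_neg, zpow_natCast, one_div, inv_pow]
      rw [h2, mul_comm ((1 / 2 : ℝ) ^ k)]
      exact (prodW_decay q h0 h1 _ hdec k).trans
        (mul_le_mul_of_nonneg_right (hterm _) (by positivity))
  · intro hq x hx
    have hS1 : 1 ≤ ∑' j : ℕ, prodW q j := by
      have := hterm 0
      simpa [prodW] using this
    have h2 : nuAC q x ≤ prodW q x := div_le_self (prodW_pos q h0 h1 x).le hS1
    refine h2.trans ?_
    obtain ⟨k, rfl⟩ := Nat.exists_eq_add_of_le hx
    have hd : ∀ i, 1 < i → wAC q i ≤ 1 / 2 := by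
      intro i hi
      refine wAC_le_half q h0 h1 i (by omega) ?_
      have : q ^ i ≤ q ^ 1 := pow_le_pow_of_le_one h0.le h1.le (by omega)
      rw [pow_one] at this
      linarith
    refine (prodW_decay q h0 h1 1 hd k).trans ?_
    have hw : prodW q 1 ≤ 2 * q := by
      have h3 : 0 < 1 - q := by linarith
      simp only [prodW, wAC, Finset.Icc_self, Finset.prod_singleton, pow_one, mul_one]
      norm_num
      rw [div_le_iff₀ (by positivity)]
      have : 1 ≤ 2 * (1 - q) ^ 2 := by nlinarith
      nlinarith
    calc prodW q 1 * (1 / 2) ^ k ≤ 2 * q * (1 / 2) ^ k :=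
          mul_le_mul_of_nonneg_right hw (by positivity)
      _ = 4 * q / 2 ^ (1 + k) := by
          rw [pow_add, one_div, inv_pow]
          field_simp
          norm_num
end
end

section
/- Let n ≥ 1 be an integer, 0 < q < 1, and let π have the Mallows distribution μ_{n,q}. Let R := {(x,y) ∈ {1,…,n}² : x₁ ≤ x ≤ x₂, y₁ ≤ y ≤ y₂} be a discrete rectangle contained in {1,…,n}². Let G be any set with P[Γ_π ∖ R = G] > 0 and suppose m := n − |G| ≥ 1 (so on the conditioning event |Γ_π ∩ R| = m). Then, conditioned on the event {Γ_π ∖ R = G}, the relative order of Γ_π ∩ R has the Mallows distribution μ_{m,q}. -/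
open Finset
open scoped Classical BigOperators

noncomputable section

/-- The rank of the x-coordinate of `p` among the points of `S` (1-indexed). -/
def rankX {n : ℕ} (S : Finset (Fin n × Fin n)) (p : Fin n × Fin n) : ℕ :=
  (S.filter (fun p' => p'.1 ≤ p.1)).card

/-- The rank of the y-coordinate of `p` among the points of `S` (1-indexed). -/
def rankY {n : ℕ} (S : Finset (Fin n × Fin n)) (p : Fin n × Fin n) : ℕ :=
  (S.filter (fun p' => p'.2 ≤ p.2)).card

/-- `S` has relative order `lam ∈ S_m`: `S` has `m` points and for each point `p ∈ S`,
if `p` has the `i`-th smallest x-coordinate then it has the `lam(i)`-th smallest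
y-coordinate (1-indexed ranks). -/
def hasRelOrder {n : ℕ} (S : Finset (Fin n × Fin n)) {m : ℕ}
    (lam : Equiv.Perm (Fin m)) : Prop :=
  S.card = m ∧
    ∀ p ∈ S, ∀ i : Fin m, (i : ℕ) + 1 = rankX S p → ((lam i : ℕ) + 1 = rankY S p)


lemma aux_cross {n m : ℕ} (f g : Fin m ↪o Fin n) (x1 x2 y1 y2 s c : Fin n)
    (hf : ∀ i, x1 ≤ f i ∧ f i ≤ x2) (hg : ∀ i, y1 ≤ g i ∧ g i ≤ y2)
    (hs : ¬ (x1 ≤ s ∧ s ≤ x2 ∧ y1 ≤ c ∧ c ≤ y2)) (lam : Equiv.Perm (Fin m)) :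
    (∑ i, if s < f i ∧ g (lam i) < c then 1 else 0) =
      (∑ i, if s < f i ∧ g i < c then 1 else 0 : ℕ) ∧
    (∑ i, if f i < s ∧ c < g (lam i) then 1 else 0) =
      (∑ i, if f i < s ∧ c < g i then 1 else 0 : ℕ) := by
  by_cases h1 : s < x1
  · have a : ∀ i, s < f i := fun i => lt_of_lt_of_le h1 (hf i).1
    have b : ∀ i, ¬ f i < s := fun i => not_lt.2 (a i).le
    simp only [a, b, true_and, false_and, and_true]
    exact Equiv.sum_comp lam (fun i => if g i < c then 1 else 0)
  by_cases h2 : x2 < s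
  · have a : ∀ i, f i < s := fun i => lt_of_le_of_lt (hf i).2 h2
    have b : ∀ i, ¬ s < f i := fun i => not_lt.2 (a i).le
    simp only [a, b, true_and, false_and]
    exact Equiv.sum_comp lam (fun i => if c < g i then 1 else 0)
  by_cases h3 : c < y1
  · have a : ∀ i, c < g i := fun i => lt_of_lt_of_le h3 (hg i).1
    have b : ∀ i, ¬ g i < c := fun i => not_lt.2 (a i).le
    simp only [a, b, and_self]
  by_cases h4 : y2 < c
  · have a : ∀ i, g i < c := fun i => lt_of_le_of_lt (hg i).2 h4
    have b : ∀ i, ¬ c < g i := fun i => not_lt.2 (a i).le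
    simp only [a, b, and_self]
  exact absurd ⟨not_lt.1 h1, not_lt.1 h2, not_lt.1 h3, not_lt.1 h4⟩ hs

lemma aux_split {n m : ℕ} (f : Fin m ↪o Fin n) (F : Fin n → ℕ) :
    ∑ s, F s = ∑ i, F (f i) + ∑ s ∈ univ.filter (fun s => s ∉ Set.range f), F s := by
  rw [← Finset.sum_filter_add_sum_filter_not univ (fun s => s ∈ Set.range f)]
  congr 1
  rw [← Finset.sum_image (s := univ) (g := f) (f := F) (fun a _ b _ h => f.injective h)]
  congr 1
  ext s
  simp

lemma aux_invCount (n : ℕ) (π : Equiv.Perm (Fin n)) :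
    invCount n π = ∑ s, ∑ t, if s < t ∧ π t < π s then 1 else 0 := by
  unfold invCount
  rw [Finset.card_filter, Fintype.sum_prod_type]

lemma aux_inv {n m : ℕ} (f g : Fin m ↪o Fin n) (x1 x2 y1 y2 : Fin n)
    (hf : ∀ i, x1 ≤ f i ∧ f i ≤ x2) (hg : ∀ i, y1 ≤ g i ∧ g i ≤ y2)
    (π π' : Equiv.Perm (Fin n)) (lam lam' : Equiv.Perm (Fin m))
    (hπ : ∀ i, π (f i) = g (lam i)) (hπ' : ∀ i, π' (f i) = g (lam' i))
    (hoff : ∀ s, s ∉ Set.range f → π s = π' s)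
    (hs : ∀ s, s ∉ Set.range f → ¬ (x1 ≤ s ∧ s ≤ x2 ∧ y1 ≤ π' s ∧ π' s ≤ y2)) :
    invCount n π + invCount m lam' = invCount n π' + invCount m lam := by
  have key : ∀ (ρ : Equiv.Perm (Fin n)) (μ : Equiv.Perm (Fin m)),
      (∀ i, ρ (f i) = g (μ i)) → (∀ s, s ∉ Set.range f → ρ s = π' s) →
      invCount n ρ = invCount m μ +
        (∑ s ∈ univ.filter (fun s => s ∉ Set.range f),
          ∑ i, if f i < s ∧ π' s < g i then 1 else 0) +
        ((∑ s ∈ univ.filter (fun s => s ∉ Set.range f),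
          ∑ i, if s < f i ∧ g i < π' s then 1 else 0) +
        ∑ s ∈ univ.filter (fun s => s ∉ Set.range f),
          ∑ t ∈ univ.filter (fun s => s ∉ Set.range f),
            if s < t ∧ π' t < π' s then 1 else 0) := by
    intro ρ μ h1 h2
    rw [aux_invCount, aux_split f]
    congr 1
    · simp_rw [aux_split f (fun t => if _ < t ∧ ρ t < ρ _ then 1 else 0)]
      rw [Finset.sum_add_distrib, aux_invCount]
      congr 1
      · simp [h1]
      · rw [Finset.sum_comm]
        refine Finset.sum_congr rfl fun s hs' => ?_
        have hs'' := (Finset.mem_filter.1 hs').2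
        rw [h2 s hs'', ← (aux_cross f g x1 x2 y1 y2 s (π' s) hf hg (hs s hs'') μ).2]
        simp only [h1]
    · rw [← Finset.sum_add_distrib]
      refine Finset.sum_congr rfl fun s hs' => ?_
      have hs'' := (Finset.mem_filter.1 hs').2
      rw [aux_split f, h2 s hs'', ← (aux_cross f g x1 x2 y1 y2 s (π' s) hf hg (hs s hs'') μ).1]
      simp only [h1]
      congr 1
      refine Finset.sum_congr rfl fun t ht => ?_
      rw [h2 t (Finset.mem_filter.1 ht).2]
  rw [key π lam hπ hoff, key π' lam' hπ' (fun _ _ => rfl)]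
  ring

lemma aux_card {m : ℕ} (i : Fin m) : (univ.filter (fun j : Fin m => j ≤ i)).card = i + 1 := by
  have : univ.filter (fun j : Fin m => j ≤ i) = Finset.Iic i := by ext; simp
  rw [this, Fin.card_Iic]

lemma aux_rel {n m : ℕ} (f g : Fin m ↪o Fin n) (S : Finset (Fin n × Fin n))
    (lam mu : Equiv.Perm (Fin m))
    (hS : S = univ.image (fun i => (f i, g (lam i)))) : hasRelOrder S mu ↔ lam = mu := by
  have inj : Function.Injective (fun i => (f i, g (lam i))) := fun a b h =>
    f.injective (Prod.ext_iff.1 h).1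
  have hX : ∀ i, rankX S (f i, g (lam i)) = i + 1 := by
    intro i
    unfold rankX
    rw [hS, Finset.filter_image, Finset.card_image_of_injective _ inj]
    simp [aux_card]
  have hY : ∀ i, rankY S (f i, g (lam i)) = lam i + 1 := by
    intro i
    unfold rankY
    rw [hS, Finset.filter_image, Finset.card_image_of_injective _ inj]
    simp only [OrderEmbedding.le_iff_le]
    rw [← aux_card (lam i)]
    refine Finset.card_bij (fun a _ => lam a) (by simp) (by simp) ?_
    intro b hb
    exact ⟨lam.symm b, by simpa using hb, by simp⟩
  constructor
  · rintro ⟨-, h⟩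
    ext i
    have := h (f i, g (lam i)) (by rw [hS]; simp) i (hX i).symm
    rw [hY] at this
    omega
  · rintro rfl
    refine ⟨by rw [hS, Finset.card_image_of_injective _ inj]; simp, ?_⟩
    intro p hp i hi
    rw [hS] at hp
    obtain ⟨j, -, rfl⟩ := Finset.mem_image.1 hp
    rw [hX] at hi
    have : i = j := Fin.ext (by omega)
    rw [hY, this]

lemma aux_mProb (n : ℕ) (q : ℝ) (P : Equiv.Perm (Fin n) → Prop)
    (S : Finset (Equiv.Perm (Fin n))) (hS : ∀ π, π ∈ S ↔ P π) :
    mProb n q P = ∑ π ∈ S, mallowsP n q π := by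
  unfold mProb
  rw [← Finset.sum_filter]
  refine Finset.sum_congr ?_ (fun _ _ => rfl)
  ext π
  simp [hS]

lemma aux_main {n m : ℕ} (q : ℝ) (h0 : 0 < q) (f g : Fin m ↪o Fin n) (x1 x2 y1 y2 : Fin n)
    (hf : ∀ i, x1 ≤ f i ∧ f i ≤ x2) (hg : ∀ i, y1 ≤ g i ∧ g i ≤ y2)
    (π0 : Equiv.Perm (Fin n)) (σ : Equiv.Perm (Fin m))
    (hσ : ∀ i, π0 (f i) = g (σ i))
    (hs : ∀ s, s ∉ Set.range f → ¬ (x1 ≤ s ∧ s ≤ x2 ∧ y1 ≤ π0 s ∧ π0 s ≤ y2))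
    (R : Finset (Fin n × Fin n))
    (hR : ∀ s y, (s, y) ∈ R ↔ x1 ≤ s ∧ s ≤ x2 ∧ y1 ≤ y ∧ y ≤ y2)
    (mu : Equiv.Perm (Fin m)) :
    mCondProb n q (fun π => hasRelOrder (graphP n π ∩ R) mu)
      (fun π => graphP n π \ R = graphP n π0 \ R) = mallowsP m q mu := by
  have hfR : ∀ i j, (f i, g j) ∈ R := fun i j =>
    (hR _ _).2 ⟨(hf i).1, (hf i).2, (hg j).1, (hg j).2⟩
  have hex : ∀ lam : Equiv.Perm (Fin m), ∃ π : Equiv.Perm (Fin n),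
      (∀ i, π (f i) = g (lam i)) ∧ ∀ s, s ∉ Set.range f → π s = π0 s := by
    intro lam
    let e : Fin m ≃ {s // s ∈ Set.range f} := Equiv.ofInjective f f.injective
    refine ⟨π0 * (σ⁻¹ * lam).extendDomain e, ?_, ?_⟩
    · intro i
      have : (σ⁻¹ * lam).extendDomain e (f i) = f ((σ⁻¹ * lam) i) :=
        Equiv.Perm.extendDomain_apply_image (σ⁻¹ * lam) e i
      rw [Equiv.Perm.mul_apply, this, hσ]
      simp
    · intro s h
      rw [Equiv.Perm.mul_apply, Equiv.Perm.extendDomain_apply_not_subtype _ _ h]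
  choose Φ hΦ1 hΦ2 using hex
  have hinj : Function.Injective Φ := by
    intro a b h
    ext i
    have : g (a i) = g (b i) := by rw [← hΦ1, ← hΦ1, h]
    rw [g.injective this]
  have hΦE : ∀ lam, graphP n (Φ lam) \ R = graphP n π0 \ R := by
    intro lam
    ext ⟨s, y⟩
    simp only [graphP, Finset.mem_sdiff, Finset.mem_filter, Finset.mem_univ, true_and]
    by_cases h : s ∈ Set.range f
    · obtain ⟨i, rfl⟩ := h
      rw [hΦ1, hσ]
      constructor
      · rintro ⟨rfl, h⟩; exact absurd (hfR _ _) h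
      · rintro ⟨rfl, h⟩; exact absurd (hfR _ _) h
    · rw [hΦ2 lam s h]
  have hsurj : ∀ π : Equiv.Perm (Fin n), graphP n π \ R = graphP n π0 \ R → ∃ lam, Φ lam = π := by
    intro π hπ
    have hoff : ∀ s, s ∉ Set.range f → π s = π0 s := by
      intro s h
      have : (s, π0 s) ∈ graphP n π \ R := by
        rw [hπ, Finset.mem_sdiff, hR]
        exact ⟨by simp [graphP], hs s h⟩
      simpa [graphP] using (Finset.mem_sdiff.1 this).1
    have : ∀ i, ∃ j, π (f i) = g j := by
      intro i
      by_cases h : π0.symm (π (f i)) ∈ Set.range f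
      · obtain ⟨k, hk⟩ := h
        exact ⟨σ k, by rw [← hσ, hk]; simp⟩
      · have h2 := hoff _ h
        rw [Equiv.apply_symm_apply] at h2
        exact absurd ⟨i, (π.injective h2).symm⟩ h
    choose l hl using this
    have hli : Function.Injective l := by
      intro a b h
      apply f.injective
      apply π.injective
      rw [hl, hl, h]
    refine ⟨Equiv.ofBijective l (Finite.injective_iff_bijective.1 hli), ?_⟩
    apply Equiv.ext
    intro s
    by_cases h : s ∈ Set.range f
    · obtain ⟨i, rfl⟩ := h
      rw [hΦ1, hl]; rfl
    · rw [hΦ2 _ s h, hoff s h]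
  have hrel : ∀ lam, hasRelOrder (graphP n (Φ lam) ∩ R) mu ↔ lam = mu := by
    intro lam
    refine aux_rel f g _ lam mu ?_
    ext ⟨s, y⟩
    simp only [graphP, Finset.mem_inter, Finset.mem_filter, Finset.mem_univ, true_and,
      Finset.mem_image, Prod.mk.injEq]
    constructor
    · rintro ⟨rfl, h⟩
      by_cases h' : s ∈ Set.range f
      · obtain ⟨i, rfl⟩ := h'
        exact ⟨i, rfl, (hΦ1 lam i).symm⟩
      · rw [hΦ2 lam s h', hR] at h
        exact absurd h (hs s h')
    · rintro ⟨i, rfl, rfl⟩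
      exact ⟨hΦ1 lam i, hfR _ _⟩
  have hZ : ∀ k, 0 < mallowsZ k q := fun k =>
    Finset.sum_pos (fun _ _ => pow_pos h0 _) Finset.univ_nonempty
  have hP : ∀ lam, mallowsP n q (Φ lam) =
      q ^ invCount n π0 / q ^ invCount m σ / mallowsZ n q * q ^ invCount m lam := by
    intro lam
    have h := aux_inv f g x1 x2 y1 y2 hf hg (Φ lam) π0 lam σ (hΦ1 lam) hσ (hΦ2 lam) hs
    have h' : q ^ invCount n (Φ lam) * q ^ invCount m σ =
        q ^ invCount n π0 * q ^ invCount m lam := by rw [← pow_add, h, pow_add]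
    have := (hZ n).ne'
    have := (pow_pos h0 (invCount m σ)).ne'
    unfold mallowsP
    field_simp
    linarith
  have hden : mProb n q (fun π => graphP n π \ R = graphP n π0 \ R) =
      q ^ invCount n π0 / q ^ invCount m σ / mallowsZ n q * mallowsZ m q := by
    rw [aux_mProb n q _ (univ.image Φ) ?_, Finset.sum_image (fun a _ b _ h => hinj h)]
    swap
    · intro π
      simp only [Finset.mem_univ, true_and, Finset.mem_image]
      exact ⟨by rintro ⟨l, rfl⟩; exact hΦE l, hsurj π⟩
    simp_rw [hP]
    rw [← Finset.mul_sum]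
    rfl
  have hnum : mProb n q (fun π => hasRelOrder (graphP n π ∩ R) mu ∧
        graphP n π \ R = graphP n π0 \ R) =
      q ^ invCount n π0 / q ^ invCount m σ / mallowsZ n q * q ^ invCount m mu := by
    rw [aux_mProb n q _ {Φ mu} ?_, Finset.sum_singleton, hP]
    intro π
    rw [Finset.mem_singleton]
    constructor
    · rintro rfl
      exact ⟨(hrel mu).2 rfl, hΦE mu⟩
    · rintro ⟨h1, h2⟩
      obtain ⟨l, rfl⟩ := hsurj π h2
      rw [(hrel l).1 h1]
  unfold mCondProb
  rw [hnum, hden]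
  have := (hZ n).ne'
  have := (hZ m).ne'
  have := (pow_pos h0 (invCount m σ)).ne'
  have := (pow_pos h0 (invCount n π0)).ne'
  unfold mallowsP
  field_simp

theorem mallows_relative_order_in_rectangle
    (n : ℕ) (q : ℝ) (h0 : 0 < q) (h1 : q < 1)
    (x1 x2 y1 y2 : Fin n) (G : Finset (Fin n × Fin n)) (m : ℕ)
    (hpos : 0 < mProb n q (fun π =>
      graphP n π \
        Finset.univ.filter
          (fun p : Fin n × Fin n => x1 ≤ p.1 ∧ p.1 ≤ x2 ∧ y1 ≤ p.2 ∧ p.2 ≤ y2) = G))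
    (hm : m = n - G.card) (hm1 : 1 ≤ m) :
    ∀ lam : Equiv.Perm (Fin m),
      mCondProb n q
          (fun π => hasRelOrder
            (graphP n π ∩
              Finset.univ.filter
                (fun p : Fin n × Fin n => x1 ≤ p.1 ∧ p.1 ≤ x2 ∧ y1 ≤ p.2 ∧ p.2 ≤ y2))
            lam)
          (fun π => graphP n π \
            Finset.univ.filter
              (fun p : Fin n × Fin n => x1 ≤ p.1 ∧ p.1 ≤ x2 ∧ y1 ≤ p.2 ∧ p.2 ≤ y2) = G)
        = mallowsP m q lam := by
  intro lam
  set R : Finset (Fin n × Fin n) := Finset.univ.filter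
    (fun p : Fin n × Fin n => x1 ≤ p.1 ∧ p.1 ≤ x2 ∧ y1 ≤ p.2 ∧ p.2 ≤ y2) with hRdef
  have hR : ∀ s y, (s, y) ∈ R ↔ x1 ≤ s ∧ s ≤ x2 ∧ y1 ≤ y ∧ y ≤ y2 := by
    intro s y; simp [hRdef]
  obtain ⟨π0, rfl⟩ : ∃ π0 : Equiv.Perm (Fin n), graphP n π0 \ R = G := by
    by_contra hne
    push Not at hne
    simp [mProb, hne] at hpos
  let A : Finset (Fin n) := univ.filter (fun s => (s, π0 s) ∈ R)
  have hA : A.card = m := by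
    have e1 : graphP n π0 \ R = (univ.filter (fun s => ¬ (s, π0 s) ∈ R)).image
        (fun s => (s, π0 s)) := by
      ext ⟨s, y⟩
      simp only [graphP, Finset.mem_sdiff, Finset.mem_filter, Finset.mem_univ, true_and,
        Finset.mem_image, Prod.mk.injEq]
      constructor
      · rintro ⟨rfl, h⟩; exact ⟨s, h, rfl, rfl⟩
      · rintro ⟨t, h, rfl, rfl⟩; exact ⟨rfl, h⟩
    have e2 := Finset.card_filter_add_card_filter_not (s := (univ : Finset (Fin n)))
      (fun s => (s, π0 s) ∈ R)
    rw [e1, Finset.card_image_of_injective _ (fun a b h => (Prod.ext_iff.1 h).1)] at hm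
    rw [Finset.card_univ, Fintype.card_fin] at e2
    change A.card + _ = n at e2
    omega
  have hB : (A.image π0).card = m := by
    rw [Finset.card_image_of_injective _ π0.injective, hA]
  let f := A.orderEmbOfFin hA
  let g := (A.image π0).orderEmbOfFin hB
  have hfr : ∀ s, s ∈ Set.range f ↔ (s, π0 s) ∈ R := by
    intro s
    rw [Finset.range_orderEmbOfFin]
    simp [A]
  have hgr : ∀ y, y ∈ Set.range g ↔ ∃ s, (s, π0 s) ∈ R ∧ π0 s = y := by
    intro y
    rw [Finset.range_orderEmbOfFin]
    simp only [A, Finset.coe_image, Set.mem_image, Finset.mem_coe, Finset.mem_filter,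
      Finset.mem_univ, true_and]
  have hex : ∀ i, ∃ j, π0 (f i) = g j := by
    intro i
    obtain ⟨j, hj⟩ := (hgr (π0 (f i))).2 ⟨f i, (hfr _).1 ⟨i, rfl⟩, rfl⟩
    exact ⟨j, hj.symm⟩
  choose l hl using hex
  have hli : Function.Injective l := by
    intro a b h
    apply f.injective
    apply π0.injective
    rw [hl, hl, h]
  refine aux_main q h0 f g x1 x2 y1 y2 ?_ ?_ π0
    (Equiv.ofBijective l (Finite.injective_iff_bijective.1 hli)) hl ?_ R hR lam
  · intro i
    have := (hR _ _).1 ((hfr _).1 ⟨i, rfl⟩)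
    exact ⟨this.1, this.2.1⟩
  · intro i
    obtain ⟨s, h, h2⟩ := (hgr _).1 ⟨i, rfl⟩
    rw [hR, h2] at h
    exact h.2.2
  · intro s h h2
    exact h ((hfr s).2 ((hR _ _).2 h2))
end
end

section
/- Let n ≥ 1 be an integer, 0 < q < 1, and let π have the Mallows distribution μ_{n,q}. Fix s ∈ {1,…,n} and 0 ≤ t < n. Let a_1,…,a_t be distinct elements of {1,…,n} and set c := |{j : 1 ≤ j ≤ s, j ∉ {a_1,…,a_t}}|. Then P[π(t+1) ≤ s | π(1)=a_1,…,π(t)=a_t] = (1−q^c)/(1−q^{n−t}). Equivalently, for the process χ_u := |{i : u < i ≤ n, π(i) ≤ s}|, conditioned on π(1)=a_1,…,π(t)=a_t (which determines χ_t = c), one has P[χ_{t+1} = χ_t − 1] = (1−q^{χ_t})/(1−q^{n−t}) and P[χ_{t+1} = χ_t] = (q^{χ_t}−q^{n−t})/(1−q^{n−t}). -/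
open Finset
open scoped Classical BigOperators

noncomputable section

/-- The process `χ_u = |{i : u < i ≤ n, π(i) ≤ s}|` (with 1-indexed positions and
values; here expressed via 0-indexed positions/values of a permutation of `Fin n`). -/
def chi (n s u : ℕ) (π : Equiv.Perm (Fin n)) : ℕ :=
  (Finset.univ.filter (fun i : Fin n => u ≤ (i : ℕ) ∧ ((π i : ℕ) + 1) ≤ s)).card

lemma invCount_eq_sum (n : ℕ) (π : Equiv.Perm (Fin n)) :
    invCount n π = ∑ i : Fin n, (univ.filter (fun j : Fin n => i < j ∧ π j < π i)).card := by
  unfold invCount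
  rw [Finset.card_filter, ← Finset.univ_product_univ, Finset.sum_product]
  refine Finset.sum_congr rfl fun i _ => ?_
  rw [Finset.card_filter]

lemma invCount_swap (n : ℕ) (π : Equiv.Perm (Fin n)) (t k : Fin n) (htk : t < k)
    (hv : π t < π k) (hb : ∀ j, t < j → ¬ (π t < π j ∧ π j < π k)) :
    invCount n (π * Equiv.swap t k) = invCount n π + 1 := by
  have hk : (π * Equiv.swap t k) k = π t := by simp
  have ht : (π * Equiv.swap t k) t = π k := by simp
  have ho : ∀ j, j ≠ t → j ≠ k → (π * Equiv.swap t k) j = π j := by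
    intro j h1 h2
    simp [Equiv.swap_apply_of_ne_of_ne h1 h2]
  have hinj : ∀ i j, π i = π j → i = j := fun i j h => π.injective h
  rw [invCount_eq_sum, invCount_eq_sum]
  have key : ∀ i : Fin n,
      (univ.filter (fun j : Fin n => i < j ∧ (π * Equiv.swap t k) j < (π * Equiv.swap t k) i)).card
      = (univ.filter (fun j : Fin n => i < j ∧ π j < π i)).card + if i = t then 1 else 0 := by
    intro i
    rcases lt_trichotomy i t with h | h | h
    · rw [if_neg h.ne, add_zero]
      refine Finset.card_bij (fun j _ => Equiv.swap t k j) ?_ ?_ ?_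
      · intro j hj
        simp only [mem_filter, mem_univ, true_and] at hj ⊢
        rw [ho i h.ne (h.trans htk).ne] at hj
        refine ⟨?_, hj.2⟩
        by_cases h1 : j = t
        · subst h1; simpa using h.trans htk
        by_cases h2 : j = k
        · subst h2; simpa using h
        rw [Equiv.swap_apply_of_ne_of_ne h1 h2]; exact hj.1
      · intro x _ y _ hxy
        exact (Equiv.swap t k).injective hxy
      · intro j hj
        simp only [mem_filter, mem_univ, true_and] at hj
        refine ⟨Equiv.swap t k j, ?_, by simp⟩
        simp only [mem_filter, mem_univ, true_and]
        rw [ho i h.ne (h.trans htk).ne]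
        refine ⟨?_, by simpa using hj.2⟩
        by_cases h1 : j = t
        · subst h1; simpa using h.trans htk
        by_cases h2 : j = k
        · subst h2; simpa using h
        rw [Equiv.swap_apply_of_ne_of_ne h1 h2]; exact hj.1
    · subst h
      rw [if_pos rfl, ← Finset.card_insert_of_notMem (a := k)
        (s := univ.filter (fun j : Fin n => i < j ∧ π j < π i))]
      · congr 1
        ext j
        simp only [mem_filter, mem_univ, true_and, mem_insert, ht]
        by_cases h2 : j = k
        · subst h2; simp [htk, hv]
        by_cases h1 : j = i
        · subst h1; simp [h2]
        rw [ho j h1 h2]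
        have := hb j
        have := hinj j i
        have := hinj j k
        grind
      · simp only [mem_filter, mem_univ, true_and]
        grind
    · rw [if_neg h.ne', add_zero]
      congr 1
      ext j
      simp only [mem_filter, mem_univ, true_and]
      have e1 := hb j
      have e2 := hb i
      have := hinj j t
      have := hinj j k
      have := hinj i t
      have := hinj i k
      by_cases h1 : i < j
      · have h2 : j ≠ t := (h.trans h1).ne'
        have h3 : i ≠ t := h.ne'
        by_cases h4 : j = k
        · subst h4
          rw [hk, ho i h3 h1.ne]
          grind
        · rw [ho j h2 h4]
          by_cases h5 : i = k
          · subst h5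
            rw [hk]
            grind
          · rw [ho i h3 h5]
      · simp [h1]
  rw [Finset.sum_congr rfl fun i _ => key i, Finset.sum_add_distrib]
  simp

/-- total weight of the permutations satisfying `C` -/
def wSum (n : ℕ) (q : ℝ) (C : Equiv.Perm (Fin n) → Prop) : ℝ :=
  ∑ π : Equiv.Perm (Fin n), if C π then q ^ invCount n π else 0

section aux
variable (n : ℕ) (q : ℝ) (t : ℕ) (ht : t < n) (a : Fin n → Fin n)

/-- weight of permutations with the given prefix and value `v` at position `t` -/
def wAt (v : Fin n) : ℝ := wSum n q fun π =>
  π ⟨t, ht⟩ = v ∧ ∀ i : Fin n, (i : ℕ) < t → π i = a i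

/-- weight of permutations with the given prefix and value less than `s` at position `t` -/
def gLt (s : ℕ) : ℝ := wSum n q fun π =>
  (π ⟨t, ht⟩ : ℕ) + 1 ≤ s ∧ ∀ i : Fin n, (i : ℕ) < t → π i = a i

/-- number of unused values less than `s` -/
def cLt (s : ℕ) : ℕ := (Finset.univ.filter
      (fun j : Fin n => (j : ℕ) + 1 ≤ s ∧ ∀ i : Fin n, (i : ℕ) < t → a i ≠ j)).card

lemma wAt_step (v w : Fin n) (hvw : v < w)
    (hv : ∀ i : Fin n, (i : ℕ) < t → a i ≠ v) (hw : ∀ i : Fin n, (i : ℕ) < t → a i ≠ w)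
    (hb : ∀ u, v < u → u < w → ¬ ∀ i : Fin n, (i : ℕ) < t → a i ≠ u) :
    wAt n q t ht a w = q * wAt n q t ht a v := by
  unfold wAt wSum
  rw [Finset.mul_sum]
  symm
  refine Fintype.sum_equiv (Equiv.mulLeft (Equiv.swap v w)) _ _ fun π => ?_
  have hiff : (π ⟨t, ht⟩ = v ∧ ∀ i : Fin n, (i : ℕ) < t → π i = a i) ↔
      (Equiv.swap v w (π ⟨t, ht⟩) = w ∧ ∀ i : Fin n, (i : ℕ) < t → Equiv.swap v w (π i) = a i) := by
    refine and_congr ?_ (forall_congr' fun i => imp_congr_right fun hi => ?_)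
    · rw [Equiv.swap_apply_eq_iff, Equiv.swap_apply_right]
    · rw [Equiv.swap_apply_eq_iff, Equiv.swap_apply_of_ne_of_ne (hv i hi) (hw i hi)]
  have hco : Equiv.mulLeft (Equiv.swap v w) π = Equiv.swap v w * π := rfl
  rw [hco]
  by_cases h : (π ⟨t, ht⟩ = v ∧ ∀ i : Fin n, (i : ℕ) < t → π i = a i)
  · rw [if_pos h]
    refine Eq.trans ?_ (if_pos (hiff.1 h)).symm
    obtain ⟨h1, h2⟩ := h
    have hpk : π (π.symm w) = w := by simp
    generalize π.symm w = k at hpk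
    have htk : (⟨t, ht⟩ : Fin n) < k := by
      rcases lt_trichotomy (⟨t, ht⟩ : Fin n) k with h | h | h
      · exact h
      · rw [h] at h1; exact absurd (h1.symm.trans hpk) hvw.ne
      · exact absurd ((h2 k h).symm.trans hpk) (hw k h)
    have e : Equiv.swap v w * π = π * Equiv.swap ⟨t, ht⟩ k := by
      rw [Equiv.mul_swap_eq_swap_mul, h1, hpk]
    rw [e, invCount_swap n π _ k htk (by rw [h1, hpk]; exact hvw), pow_succ']
    intro j hj ⟨hj1, hj2⟩
    rw [h1] at hj1
    rw [hpk] at hj2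
    apply hb _ hj1 hj2
    intro i hi hai
    rw [← h2 i hi] at hai
    have := π.injective hai
    subst this
    have : t < (i : ℕ) := hj
    omega
  · rw [if_neg h, mul_zero]
    exact (if_neg (fun h' => h (hiff.2 h'))).symm

lemma cLt_succ (v : Fin n) (hv : ∀ i : Fin n, (i : ℕ) < t → a i ≠ v) :
    cLt n t a (v + 1) = cLt n t a v + 1 := by
  unfold cLt
  rw [← Finset.card_insert_of_notMem (a := v)]
  · congr 1
    ext j
    simp only [mem_filter, mem_univ, true_and, mem_insert]
    by_cases h : j = v
    · subst h; simpa using hv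
    · have : (j : ℕ) ≠ v := fun h' => h (Fin.ext h')
      simp only [h, false_or]
      exact and_congr_left fun _ => by omega
  · simp

lemma cLt_succ' (v : Fin n) (hv : ¬ ∀ i : Fin n, (i : ℕ) < t → a i ≠ v) :
    cLt n t a (v + 1) = cLt n t a v := by
  unfold cLt
  congr 1
  ext j
  simp only [mem_filter, mem_univ, true_and]
  by_cases h : j = v
  · subst h; simp [hv]
  · have : (j : ℕ) ≠ v := fun h' => h (Fin.ext h')
    exact and_congr_left fun _ => by omega

lemma gLt_succ (v : Fin n) :
    gLt n q t ht a (v + 1) = gLt n q t ht a v + wAt n q t ht a v := by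
  unfold gLt wAt wSum
  rw [← Finset.sum_add_distrib]
  refine Finset.sum_congr rfl fun π _ => ?_
  by_cases h : ∀ i : Fin n, (i : ℕ) < t → π i = a i
  · have h3 : π ⟨t, ht⟩ = v ↔ (π ⟨t, ht⟩ : ℕ) = v := Fin.ext_iff
    simp only [h3, and_iff_left h]
    rcases lt_trichotomy (π ⟨t, ht⟩ : ℕ) v with h' | h' | h'
    · rw [if_pos (by omega), if_pos (by omega), if_neg (by omega), add_zero]
    · rw [if_pos (by omega), if_neg (by omega), if_pos (by omega), zero_add]
    · rw [if_neg (by omega), if_neg (by omega), if_neg (by omega), zero_add]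
  · simp [h]

lemma wAt_zero (v : Fin n) (hv : ¬ ∀ i : Fin n, (i : ℕ) < t → a i ≠ v) :
    wAt n q t ht a v = 0 := by
  unfold wAt wSum
  refine Finset.sum_eq_zero fun π _ => if_neg ?_
  rintro ⟨h1, h2⟩
  apply hv
  intro i hi h
  rw [← h2 i hi, ← h1] at h
  have := π.injective h
  rw [this] at hi
  simp at hi

/-- Walking up the values. -/
lemma wAt_geom : ∃ W : ℝ, ∀ s : ℕ, ∀ v : Fin n, (v : ℕ) = s →
    (∀ i : Fin n, (i : ℕ) < t → a i ≠ v) → wAt n q t ht a v = q ^ cLt n t a v * W := by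
  by_cases hR : (univ.filter (fun j : Fin n => ∀ i : Fin n, (i : ℕ) < t → a i ≠ j)).Nonempty
  · set R := univ.filter (fun j : Fin n => ∀ i : Fin n, (i : ℕ) < t → a i ≠ j) with hRdef
    refine ⟨wAt n q t ht a (R.min' hR), fun s => ?_⟩
    induction s using Nat.strong_induction_on with
    | _ s ih =>
    intro v hvs hv
    by_cases hF : (R.filter (fun j => j < v)).Nonempty
    · obtain ⟨u, hmem, hmax⟩ : ∃ u, u ∈ R.filter (fun j => j < v) ∧
          ∀ x, x ∈ R.filter (fun j => j < v) → x ≤ u :=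
        ⟨_, Finset.max'_mem _ hF, fun u hu => Finset.le_max' (R.filter (fun j => j < v)) u hu⟩
      simp only [hRdef, mem_filter, mem_univ, true_and] at hmem hmax
      obtain ⟨hu, huv⟩ := hmem
      rw [wAt_step n q t ht a u v huv hu hv, ih u (by rw [← hvs]; exact huv) u rfl hu]
      · have : cLt n t a v = cLt n t a u + 1 := by
          rw [← cLt_succ n t a u hu]
          unfold cLt
          congr 1
          ext j
          simp only [mem_filter, mem_univ, true_and]
          refine and_congr_left fun hj => ?_
          have := hmax j
          simp only [Fin.lt_def, Fin.le_def] at this huv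
          constructor
          · intro h; have := this ⟨hj, by omega⟩; omega
          · intro h; omega
        rw [this]; ring
      · intro x hx1 hx2 hx
        exact absurd (hmax x ⟨hx, hx2⟩) (not_le.2 hx1)
    · rw [Finset.not_nonempty_iff_eq_empty, Finset.filter_eq_empty_iff] at hF
      have h1 : R.min' hR = v := by
        apply le_antisymm
        · exact Finset.min'_le _ _ (by simpa [hRdef] using hv)
        · exact not_lt.1 (hF (Finset.min'_mem _ _))
      have h2 : cLt n t a v = 0 := by
        unfold cLt
        rw [Finset.card_eq_zero, Finset.filter_eq_empty_iff]
        rintro j - ⟨h, hj⟩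
        exact hF (by simpa [hRdef] using hj : j ∈ R) (by rw [Fin.lt_def]; omega)
      rw [h1, h2]; simp
  · refine ⟨0, fun s v _ hv => ?_⟩
    exact absurd ⟨v, by simpa using hv⟩ hR

lemma gLt_eq : ∃ W : ℝ, ∀ s : ℕ, s ≤ n →
    (1 - q) * gLt n q t ht a s = (1 - q ^ cLt n t a s) * W := by
  obtain ⟨W, hW⟩ := wAt_geom n q t ht a
  refine ⟨W, fun s => ?_⟩
  induction s with
  | zero => intro _; simp [gLt, cLt, wSum]
  | succ s ih =>
    intro hs
    have h1 := gLt_succ n q t ht a ⟨s, hs⟩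
    have ih := ih (by omega)
    simp only at h1
    rw [h1, mul_add, ih]
    by_cases hv : ∀ i : Fin n, (i : ℕ) < t → a i ≠ ⟨s, hs⟩
    · have h2 := cLt_succ n t a ⟨s, hs⟩ hv
      have h3 := hW s ⟨s, hs⟩ rfl hv
      simp only at h2 h3
      rw [h2, h3]; ring
    · have h2 := cLt_succ' n t a ⟨s, hs⟩ hv
      simp only at h2
      rw [wAt_zero n q t ht a _ hv, h2]; ring

lemma cLt_top (ht : t < n)
    (ha : ∀ i i' : Fin n, (i : ℕ) < t → (i' : ℕ) < t → a i = a i' → i = i') :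
    cLt n t a n = n - t := by
  unfold cLt
  have : (univ.filter (fun j : Fin n => (j : ℕ) + 1 ≤ n ∧ ∀ i : Fin n, (i : ℕ) < t → a i ≠ j))
      = ((univ.filter (fun i : Fin n => (i : ℕ) < t)).image a)ᶜ := by
    ext j
    have := j.2
    simp only [mem_filter, mem_univ, true_and, mem_compl, mem_image, not_exists, not_and]
    constructor
    · exact fun h => h.2
    · exact fun h => ⟨by omega, h⟩
  rw [this, Finset.card_compl, Finset.card_image_of_injOn, Fintype.card_fin]
  · have : (univ.filter (fun i : Fin n => (i : ℕ) < t)) = Finset.Iio ⟨t, ht⟩ := by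
      ext i; simp [Fin.lt_def]
    rw [this, Fin.card_Iio]
  · intro i hi j hj h
    simp at hi hj
    exact ha i j hi hj h

lemma exists_ext
    (ha : ∀ i i' : Fin n, (i : ℕ) < t → (i' : ℕ) < t → a i = a i' → i = i') :
    ∃ π : Equiv.Perm (Fin n), ∀ i : Fin n, (i : ℕ) < t → π i = a i := by
  obtain ⟨g, hg⟩ := Set.MapsTo.exists_equiv_extend_of_card_eq (α := Fin n) (β := Fin n)
    (t := univ) (by simp) (s := {i : Fin n | (i : ℕ) < t}) (f := a)
    (fun _ _ => by simp) (fun i hi j hj h => ha i j hi hj h)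
  refine ⟨g.trans ⟨fun x => x.1, fun x => ⟨x, mem_univ x⟩, fun _ => rfl, fun _ => rfl⟩,
    fun i hi => hg i hi⟩

lemma condProb_eq (h0 : 0 < q) (A B : Equiv.Perm (Fin n) → Prop) :
    mCondProb n q A B = wSum n q (fun π => A π ∧ B π) / wSum n q B := by
  have hZ : 0 < mallowsZ n q := Finset.sum_pos (fun _ _ => by positivity) ⟨1, mem_univ _⟩
  have h : ∀ C : Equiv.Perm (Fin n) → Prop,
      mProb n q C = wSum n q C / mallowsZ n q := by
    intro C
    unfold mProb mallowsP wSum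
    rw [Finset.sum_div]
    refine Finset.sum_congr rfl fun π _ => ?_
    split_ifs <;> simp
  unfold mCondProb
  rw [h, h, div_div_div_cancel_right₀ hZ.ne']

lemma chi_succ (s : ℕ) (π : Equiv.Perm (Fin n)) :
    chi n s t π = chi n s (t + 1) π + if (π ⟨t, ht⟩ : ℕ) + 1 ≤ s then 1 else 0 := by
  unfold chi
  split_ifs with h
  · rw [← Finset.card_insert_of_notMem (a := (⟨t, ht⟩ : Fin n))]
    · congr 1
      ext j
      simp only [mem_filter, mem_univ, true_and, mem_insert]
      by_cases hj : j = ⟨t, ht⟩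
      · subst hj; simpa using h
      · have : (j : ℕ) ≠ t := fun h' => hj (Fin.ext h')
        simp only [hj, false_or]
        exact and_congr_left fun _ => by omega
    · simp
  · rw [add_zero]
    congr 1
    ext j
    simp only [mem_filter, mem_univ, true_and]
    by_cases hj : j = ⟨t, ht⟩
    · subst hj; simp; omega
    · have : (j : ℕ) ≠ t := fun h' => hj (Fin.ext h')
      exact and_congr_left fun _ => by omega

end aux

theorem mallows_chi_transition
    (n : ℕ) (q : ℝ) (h0 : 0 < q) (h1 : q < 1)
    (s : ℕ) (hs1 : 1 ≤ s) (hsn : s ≤ n)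
    (t : ℕ) (ht : t < n) (a : Fin n → Fin n)
    (ha : ∀ i i' : Fin n, (i : ℕ) < t → (i' : ℕ) < t → a i = a i' → i = i')
    (c : ℕ)
    (hc : c = (Finset.univ.filter
      (fun j : Fin n => (j : ℕ) + 1 ≤ s ∧ ∀ i : Fin n, (i : ℕ) < t → a i ≠ j)).card) :
    mCondProb n q (fun π => ((π ⟨t, ht⟩ : ℕ) + 1) ≤ s)
        (fun π => ∀ i : Fin n, (i : ℕ) < t → π i = a i)
      = (1 - q ^ c) / (1 - q ^ (n - t)) ∧
    mCondProb n q (fun π => (chi n s (t + 1) π : ℤ) = (chi n s t π : ℤ) - 1)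
        (fun π => ∀ i : Fin n, (i : ℕ) < t → π i = a i)
      = (1 - q ^ c) / (1 - q ^ (n - t)) ∧
    mCondProb n q (fun π => chi n s (t + 1) π = chi n s t π)
        (fun π => ∀ i : Fin n, (i : ℕ) < t → π i = a i)
      = (q ^ c - q ^ (n - t)) / (1 - q ^ (n - t)) := by
  have hB : 0 < wSum n q (fun π =>
      ∀ i : Fin n, (i : ℕ) < t → π i = a i) := by
    obtain ⟨π, hπ⟩ := exists_ext n t a ha
    refine Finset.sum_pos' (fun σ _ => ?_) ⟨π, mem_univ _, ?_⟩
    · split_ifs <;> positivity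
    · rw [if_pos hπ]; positivity
  have hgn : gLt n q t ht a n = wSum n q (fun π =>
      ∀ i : Fin n, (i : ℕ) < t → π i = a i) := by
    unfold gLt wSum
    refine Finset.sum_congr rfl fun π _ => ?_
    have : (π ⟨t, ht⟩ : ℕ) + 1 ≤ n := (π ⟨t, ht⟩).2
    by_cases hb : ∀ i : Fin n, (i : ℕ) < t → π i = a i
    · rw [if_pos ⟨this, hb⟩, if_pos hb]
    · rw [if_neg (fun h => hb h.2), if_neg hb]
  have hm : 0 < 1 - q ^ (n - t) := by
    have := pow_lt_one₀ h0.le h1 (show n - t ≠ 0 by omega)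
    linarith
  have hq : 0 < 1 - q := by linarith
  have first : mCondProb n q (fun π => ((π ⟨t, ht⟩ : ℕ) + 1) ≤ s)
        (fun π => ∀ i : Fin n, (i : ℕ) < t → π i = a i)
      = (1 - q ^ c) / (1 - q ^ (n - t)) := by
    rw [condProb_eq n q h0, ← hgn]
    obtain ⟨W, hW⟩ := gLt_eq n q t ht a
    have e1 := hW s hsn
    have e2 := hW n le_rfl
    rw [cLt_top n t a ht ha] at e2
    have hcc : cLt n t a s = c := hc.symm
    rw [hcc] at e1
    change gLt n q t ht a s / _ = _
    rw [← hgn] at hB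
    rw [div_eq_div_iff hB.ne' hm.ne']
    apply mul_left_cancel₀ hq.ne'
    linear_combination (1 - q ^ (n - t)) * e1 - (1 - q ^ c) * e2
  refine ⟨first, ?_, ?_⟩
  · rw [← first]
    congr 1
    ext π
    have := chi_succ n t ht s π
    split_ifs at this with h
    · simp only [h, iff_true]; omega
    · simp only [h, iff_false]; omega
  · have e : (q ^ c - q ^ (n - t)) / (1 - q ^ (n - t)) =
        1 - (1 - q ^ c) / (1 - q ^ (n - t)) := by
      field_simp; ring
    rw [e, ← first, condProb_eq n q h0, condProb_eq n q h0, eq_sub_iff_add_eq, ← add_div,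
      div_eq_one_iff_eq hB.ne']
    unfold wSum
    rw [← Finset.sum_add_distrib]
    refine Finset.sum_congr rfl fun π _ => ?_
    have := chi_succ n t ht s π
    by_cases hb : ∀ i : Fin n, (i : ℕ) < t → π i = a i
    · simp only [and_iff_left hb, if_pos hb]
      by_cases h : (π ⟨t, ht⟩ : ℕ) + 1 ≤ s
      · rw [if_pos h] at this
        rw [if_neg (by omega), if_pos h, zero_add]
      · rw [if_neg h] at this
        rw [if_pos (by omega), if_neg h, add_zero]
    · simp [hb]
end
end
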